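/- If α ≥ α_th, then C_H(A, αA) ≥ (1/2)·log(1 + A^{2nr}·V_H² / (2πe)^{nr}). -/

import Mathlib

open MeasureTheory ProbabilityTheory Matrix Filter Topology
open scoped ENNReal NNReal BigOperators

noncomputable section

namespace MimoOptical

variable {nt nr : ℕ}

/-- The law of a standard Gaussian vector `Z ~ N(0, I_n)` on `ℝ^n`. -/
def stdGaussian (n : ℕ) : Measure (Fin n → ℝ) :=
  Measure.pi fun _ => gaussianReal 0 1

/-- Real-valued Kullback–Leibler divergence `∫ log (dμ/dν) dμ`
(with junk value if not absolutely continuous or not integrable). -/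
def klDivR {Ω : Type*} [MeasurableSpace Ω] (μ ν : Measure Ω) : ℝ :=
  ∫ ω, Real.log (μ.rnDeriv ν ω).toReal ∂μ

/-- Mutual information of a joint law on a product space: the KL divergence between
the joint law and the product of its marginals. -/
def mutualInfoJoint {β γ : Type*} [MeasurableSpace β] [MeasurableSpace γ]
    (π : Measure (β × γ)) : ℝ :=
  klDivR π ((π.map Prod.fst).prod (π.map Prod.snd))

/-- Joint law of `(X, H X + Z)` where `X ~ μ` and `Z ~ N(0, I_nr)` is independent of `X`. -/
def jointLaw (H : Matrix (Fin nr) (Fin nt) ℝ) (μ : Measure (Fin nt → ℝ)) :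
    Measure ((Fin nt → ℝ) × (Fin nr → ℝ)) :=
  (μ.prod (stdGaussian nr)).map (fun p => (p.1, H.mulVec p.1 + p.2))

/-- An admissible input distribution: a probability measure on `[0, A]^nt`
with average power `E[‖X‖₁] ≤ avg`. -/
def Admissible (nt : ℕ) (A avg : ℝ) (μ : Measure (Fin nt → ℝ)) : Prop :=
  IsProbabilityMeasure μ ∧ (∀ᵐ x ∂μ, ∀ k, x k ∈ Set.Icc (0 : ℝ) A) ∧
    (∫ x, ∑ k, |x k| ∂μ) ≤ avg

/-- Capacity of the MIMO optical intensity channel with peak power `A` and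
average power `avg`. -/
def capacity (H : Matrix (Fin nr) (Fin nt) ℝ) (A avg : ℝ) : ℝ :=
  sSup { c | ∃ μ : Measure (Fin nt → ℝ),
    Admissible nt A avg μ ∧ c = mutualInfoJoint (jointLaw H μ) }

/-- The zonotope `R(M) = { M λ : λ ∈ [0,A]^k }`. -/
def zonotope {n k : ℕ} (M : Matrix (Fin n) (Fin k) ℝ) (A : ℝ) : Set (Fin n → ℝ) :=
  { x | ∃ lam : Fin k → ℝ, (∀ i, lam i ∈ Set.Icc 0 A) ∧ x = M.mulVec lam }

/-- The collection `𝒰` of `nr`-element subsets of columns that are linearly independent. -/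
def goodSets (H : Matrix (Fin nr) (Fin nt) ℝ) : Set (Finset (Fin nt)) :=
  { U | U.card = nr ∧ LinearIndependent ℝ (fun j : {x // x ∈ U} => fun i => H i j.1) }

/-- The square matrix `H_U` whose columns are the columns of `H` indexed by `U`
(junk value, the identity, if `U.card ≠ nr`). -/
def HU (H : Matrix (Fin nr) (Fin nt) ℝ) (U : Finset (Fin nt)) :
    Matrix (Fin nr) (Fin nr) ℝ :=
  if h : U.card = nr then H.submatrix id (fun i => U.orderEmbOfFin h i) else 1

/-- `a_{U,j} = 1ᵀ H_U⁻¹ h_j`. -/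
def aUj (H : Matrix (Fin nr) (Fin nt) ℝ) (U : Finset (Fin nt)) (j : Fin nt) : ℝ :=
  ∑ i, ((HU H U)⁻¹).mulVec (fun r => H r j) i

/-- `g_{U,j} = 1` if `a_{U,j} > 1` and `0` otherwise. -/
def gUj (H : Matrix (Fin nr) (Fin nt) ℝ) (U : Finset (Fin nt)) (j : Fin nt) : ℝ :=
  if 1 < aUj H U j then 1 else 0

/-- `s_U = Σ_{j ∈ Uᶜ} g_{U,j}`. -/
def sU (H : Matrix (Fin nr) (Fin nt) ℝ) (U : Finset (Fin nt)) : ℝ :=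
  ∑ j ∈ Uᶜ, gUj H U j

/-- `v_U = A Σ_{j ∈ Uᶜ} g_{U,j} h_j`. -/
def vU (H : Matrix (Fin nr) (Fin nt) ℝ) (A : ℝ) (U : Finset (Fin nt)) : Fin nr → ℝ :=
  fun r => A * ∑ j ∈ Uᶜ, gUj H U j * H r j

/-- The parallelepiped `D_U = R(H_U)`. -/
def DU (H : Matrix (Fin nr) (Fin nt) ℝ) (A : ℝ) (U : Finset (Fin nt)) :
    Set (Fin nr → ℝ) :=
  zonotope (HU H U) A

/-- The shifted parallelepiped `v_U + D_U`. -/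
def cell (H : Matrix (Fin nr) (Fin nt) ℝ) (A : ℝ) (U : Finset (Fin nt)) :
    Set (Fin nr → ℝ) :=
  (fun d => vU H A U + d) '' DU H A U

/-- `V_H = Σ_{U ∈ 𝒰} |det H_U|`. -/
def VH (H : Matrix (Fin nr) (Fin nt) ℝ) : ℝ :=
  ∑ᶠ U ∈ goodSets H, |(HU H U).det|

/-- `q_U = |det H_U| / V_H`. -/
def qU (H : Matrix (Fin nr) (Fin nt) ℝ) (U : Finset (Fin nt)) : ℝ :=
  |(HU H U).det| / VH H

/-- `α_th = nr/2 + Σ_{U ∈ 𝒰} s_U q_U`. -/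
def alphaTh (H : Matrix (Fin nr) (Fin nt) ℝ) : ℝ :=
  (nr : ℝ) / 2 + ∑ᶠ U ∈ goodSets H, sU H U * qU H U

/-- A probability vector on `𝒰`. -/
def ProbVec (H : Matrix (Fin nr) (Fin nt) ℝ) (p : Finset (Fin nt) → ℝ) : Prop :=
  (∀ U, 0 ≤ p U) ∧ (∀ U, U ∉ goodSets H → p U = 0) ∧ (∑ᶠ U ∈ goodSets H, p U) = 1

/-- Kullback–Leibler divergence `D(p‖q)` between probability vectors on `𝒰`. -/
def Dkl (H : Matrix (Fin nr) (Fin nt) ℝ) (p q : Finset (Fin nt) → ℝ) : ℝ :=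
  ∑ᶠ U ∈ goodSets H, p U * Real.log (p U / q U)

/-- `σ_{U,ℓ}`: square root of the `ℓ`-th diagonal entry of `H_U⁻¹ (H_U⁻¹)ᵀ`. -/
def sigmaUl (H : Matrix (Fin nr) (Fin nt) ℝ) (U : Finset (Fin nt)) (ℓ : Fin nr) : ℝ :=
  Real.sqrt ((((HU H U)⁻¹) * ((HU H U)⁻¹)ᵀ) ℓ ℓ)

/-- The trace of the covariance matrix of `X̄ = H X` when `X ~ μ`. -/
def traceCov (H : Matrix (Fin nr) (Fin nt) ℝ) (μ : Measure (Fin nt → ℝ)) : ℝ :=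
  ∑ i, ((∫ x, (H.mulVec x i) ^ 2 ∂μ) - (∫ x, H.mulVec x i ∂μ) ^ 2)

/-- The Gaussian Q-function. -/
def Qf (x : ℝ) : ℝ :=
  ∫ t in Set.Ioi x, Real.exp (-t ^ 2 / 2) / Real.sqrt (2 * Real.pi)

/-- The high-SNR penalty `ν` due to the average-power constraint. -/
def nuVal (H : Matrix (Fin nr) (Fin nt) ℝ) (α : ℝ) : ℝ :=
  sSup { y | ∃ lam mu : ℝ,
    lam ∈ Set.Ioo (max 0 ((nr : ℝ) / 2 + α - alphaTh H)) (min ((nr : ℝ) / 2) α) ∧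
    0 < mu ∧
    1 / mu - Real.exp (-mu) / (1 - Real.exp (-mu)) = lam / (nr : ℝ) ∧
    y = (nr : ℝ) * (1 - Real.log (mu / (1 - Real.exp (-mu)))
          - mu * Real.exp (-mu) / (1 - Real.exp (-mu)))
        - sInf { d | ∃ p : Finset (Fin nt) → ℝ, ProbVec H p ∧
            (∑ᶠ U ∈ goodSets H, p U * sU H U) = α - lam ∧ d = Dkl H p (qU H) } }

end MimoOptical

namespace MimoOptical

/-! ### Gaussian densities -/

/-- standard normal density -/
def ph (x : ℝ) : ℝ := gaussianPDFReal 0 1 x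

/-- standard normal density on `ℝ^n` -/
def phn (n : ℕ) (z : Fin n → ℝ) : ℝ := ∏ i, ph (z i)

lemma ph_pos (x : ℝ) : 0 < ph x := gaussianPDFReal_pos 0 1 x one_ne_zero

lemma ph_eq (x : ℝ) : ph x = (√(2 * Real.pi))⁻¹ * Real.exp (-(x ^ 2) / 2) := by
  simp [ph, gaussianPDFReal]

lemma ph_cont : Continuous ph := by
  have : ph = fun x => (√(2 * Real.pi))⁻¹ * Real.exp (-(x ^ 2) / 2) := funext ph_eq
  rw [this]; fun_prop

lemma ph_meas : Measurable ph := ph_cont.measurable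

lemma log_ph (x : ℝ) : Real.log (ph x) = -(Real.log (2 * Real.pi) / 2) - x ^ 2 / 2 := by
  have h : 0 < 2 * Real.pi := by positivity
  rw [ph_eq, Real.log_mul (by positivity) (by positivity), Real.log_inv, Real.log_exp,
    Real.log_sqrt h.le]
  ring

lemma phn_pos (n : ℕ) (z : Fin n → ℝ) : 0 < phn n z := Finset.prod_pos fun i _ => ph_pos _

lemma phn_cont (n : ℕ) : Continuous (phn n) := by
  unfold phn
  exact continuous_finsetProd _ fun i _ => ph_cont.comp (continuous_apply i)

lemma phn_meas (n : ℕ) : Measurable (phn n) := (phn_cont n).measurable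

lemma log_phn (n : ℕ) (z : Fin n → ℝ) :
    Real.log (phn n z) = -(n * (Real.log (2 * Real.pi) / 2)) - ∑ i, z i ^ 2 / 2 := by
  unfold phn
  rw [Real.log_prod (fun i _ => (ph_pos _).ne')]
  simp [log_ph, Finset.sum_sub_distrib]

lemma phn_le (n : ℕ) (z : Fin n → ℝ) : phn n z ≤ phn n 0 := by
  rw [← Real.log_le_log_iff (phn_pos _ _) (phn_pos _ _), log_phn, log_phn]
  have : 0 ≤ ∑ i, z i ^ 2 / 2 := Finset.sum_nonneg fun i _ => by positivity
  simp; exact this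

lemma phn_neg (n : ℕ) (z : Fin n → ℝ) : phn n (-z) = phn n z := by
  unfold phn; simp [ph_eq]

lemma gaussian_eq : gaussianReal 0 1 = volume.withDensity fun x => ENNReal.ofReal (ph x) := by
  rw [gaussianReal_of_var_ne_zero _ one_ne_zero]; rfl

lemma ph_integrable : Integrable ph := integrable_gaussianPDFReal 0 1

lemma integral_ph : ∫ x, ph x = 1 := integral_gaussianPDFReal_eq_one 0 one_ne_zero

lemma lintegral_ph : ∫⁻ x, ENNReal.ofReal (ph x) = 1 := by
  rw [← ofReal_integral_eq_lintegral_ofReal ph_integrable (ae_of_all _ fun x => (ph_pos x).le),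
    integral_ph, ENNReal.ofReal_one]

lemma stdGaussian_eq (n : ℕ) :
    stdGaussian n = volume.withDensity fun z => ENNReal.ofReal (phn n z) := by
  unfold stdGaussian
  refine (Measure.pi_eq fun s hs => ?_)
  rw [withDensity_apply _ (MeasurableSet.univ_pi hs), volume_pi, Measure.restrict_pi_pi,
    ← ofReal_integral_eq_lintegral_ofReal]
  · unfold phn
    rw [integral_fintype_prod_eq_prod (𝕜 := ℝ) (fun _ => ph),
      ENNReal.ofReal_prod_of_nonneg
        (fun i _ => integral_nonneg fun x => (ph_pos x).le)]
    refine Finset.prod_congr rfl fun i _ => ?_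
    rw [gaussian_eq, withDensity_apply _ (hs i), ← ofReal_integral_eq_lintegral_ofReal]
    · exact ph_integrable.integrableOn
    · exact ae_of_all _ fun x => (ph_pos x).le
  · unfold phn
    exact Integrable.fintype_prod (f := fun _ => ph) fun i => ph_integrable.integrableOn
  · exact ae_of_all _ fun x => (phn_pos n x).le

instance (n : ℕ) : IsProbabilityMeasure (stdGaussian n) := by
  unfold stdGaussian; infer_instance

lemma lintegral_stdGaussian (n : ℕ) {g : (Fin n → ℝ) → ℝ≥0∞} (hg : Measurable g) :
    ∫⁻ z, g z ∂(stdGaussian n) = ∫⁻ z, ENNReal.ofReal (phn n z) * g z := by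
  rw [stdGaussian_eq, lintegral_withDensity_eq_lintegral_mul _ (by
    exact (phn_meas n).ennreal_ofReal) hg]
  rfl

lemma lintegral_phn (n : ℕ) : ∫⁻ z, ENNReal.ofReal (phn n z) = 1 := by
  have := lintegral_stdGaussian n (g := fun _ => 1) measurable_const
  simpa using this.symm

lemma integrable_sq_gauss : Integrable (fun x : ℝ => x ^ 2) (gaussianReal 0 1) := by
  have := memLp_id_gaussianReal (μ := 0) (v := 1) 2
  exact this.integrable_sq

lemma integral_sq_gauss : ∫ x : ℝ, x ^ 2 ∂(gaussianReal 0 1) = 1 := by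
  have h := variance_id_gaussianReal (μ := 0) (v := 1)
  rw [variance_eq_integral (by fun_prop)] at h
  simpa using h

lemma integrable_std_sq (n : ℕ) (i : Fin n) :
    Integrable (fun z : Fin n → ℝ => z i ^ 2) (stdGaussian n) :=
  integrable_comp_eval (μ := fun _ : Fin n => gaussianReal 0 1) integrable_sq_gauss

lemma integral_std_sq (n : ℕ) (i : Fin n) :
    ∫ z : Fin n → ℝ, z i ^ 2 ∂(stdGaussian n) = 1 := by
  have := integral_comp_eval (μ := fun _ : Fin n => gaussianReal 0 1) (i := i)
    (f := fun x : ℝ => x ^ 2) (by fun_prop)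
  rw [integral_sq_gauss] at this
  exact this

lemma integrable_std_eval (n : ℕ) (i : Fin n) :
    Integrable (fun z : Fin n → ℝ => z i) (stdGaussian n) := by
  refine integrable_eval (μ := fun _ : Fin n => gaussianReal 0 1) ?_
  exact (memLp_id_gaussianReal (μ := 0) (v := 1) 1).integrable le_rfl

lemma integral_std_eval (n : ℕ) (i : Fin n) :
    ∫ z : Fin n → ℝ, z i ∂(stdGaussian n) = 0 := by
  have := integral_eval (μ := fun _ : Fin n => gaussianReal 0 1) (i := i)
  rw [integral_id_gaussianReal] at this
  exact this

lemma integrable_log_phn (n : ℕ) : Integrable (fun z => Real.log (phn n z)) (stdGaussian n) := by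
  simp_rw [log_phn]
  exact (integrable_const _).sub
    (integrable_finsetSum _ fun i _ => (integrable_std_sq n i).div_const 2)

lemma integral_log_phn (n : ℕ) :
    ∫ z, Real.log (phn n z) ∂(stdGaussian n)
      = -(n / 2 * Real.log (2 * Real.pi * Real.exp 1)) := by
  simp_rw [log_phn]
  rw [integral_sub (integrable_const _)
    (integrable_finsetSum _ fun i _ => (integrable_std_sq n i).div_const 2),
    integral_finsetSum _ fun i _ => (integrable_std_sq n i).div_const 2]
  simp_rw [integral_div, integral_std_sq]
  rw [Real.log_mul (x := 2 * Real.pi) (y := Real.exp 1) (by positivity) (by positivity),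
    Real.log_exp]
  simp
  ring

end MimoOptical

namespace MimoOptical

/-! ### The one-dimensional transport estimate -/

lemma hasStrictDerivAt_Iic {g : ℝ → ℝ} (hg : Integrable g) {x : ℝ} (hc : ContinuousAt g x) :
    HasStrictDerivAt (fun u => ∫ t in Set.Iic u, g t) (g x) x := by
  have h := intervalIntegral.integral_hasStrictDerivAt_right (a := 0) (b := x)
    (hg.intervalIntegrable) (hg.aestronglyMeasurable.stronglyMeasurableAtFilter) hc
  have h2 : (fun u => ∫ t in Set.Iic u, g t)
      = fun u => (∫ t in Set.Iic (0 : ℝ), g t) + ∫ t in (0 : ℝ)..u, g t := by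
    funext u
    rw [← intervalIntegral.integral_Iic_sub_Iic hg.integrableOn hg.integrableOn]
    ring
  rw [h2]
  exact h.const_add _

/-- standard normal cdf -/
def Phi (x : ℝ) : ℝ := ∫ t in Set.Iic x, ph t

lemma Phi_deriv (x : ℝ) : HasStrictDerivAt Phi (ph x) x :=
  hasStrictDerivAt_Iic ph_integrable ph_cont.continuousAt

lemma Phi_cont : Continuous Phi :=
  continuous_iff_continuousAt.2 fun x => (Phi_deriv x).hasDerivAt.continuousAt

lemma Phi_strictMono : StrictMono Phi :=
  strictMono_of_deriv_pos fun x => by rw [(Phi_deriv x).hasDerivAt.deriv]; exact ph_pos x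

lemma Phi_eq_cdf (x : ℝ) : Phi x = cdf (gaussianReal 0 1) x := by
  rw [cdf_eq_real, Measure.real, gaussian_eq, withDensity_apply _ measurableSet_Iic,
    ← ofReal_integral_eq_lintegral_ofReal ph_integrable.integrableOn
      (ae_of_all _ fun x => (ph_pos x).le), ENNReal.toReal_ofReal
      (integral_nonneg fun x => (ph_pos x).le)]
  rfl

lemma Phi_surj {q : ℝ} (h0 : 0 < q) (h1 : q < 1) : ∃ x, Phi x = q := by
  have hb : Tendsto Phi atBot (𝓝 0) := by
    rw [funext Phi_eq_cdf]; exact tendsto_cdf_atBot _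
  have ht : Tendsto Phi atTop (𝓝 1) := by
    rw [funext Phi_eq_cdf]; exact tendsto_cdf_atTop _
  obtain ⟨u, hu⟩ := (hb.eventually (gt_mem_nhds h0)).exists
  obtain ⟨v, hv⟩ := (ht.eventually (lt_mem_nhds h1)).exists
  exact mem_range_of_exists_le_of_exists_ge Phi_cont ⟨u, hu.le⟩ ⟨v, hv.le⟩

lemma exists_Psi : ∃ g : ℝ → ℝ, Measurable g ∧ ∀ x, g (Phi x) = x := by
  obtain ⟨g, hg, h⟩ := (Phi_cont.measurableEmbedding Phi_strictMono.injective).exists_measurable_extend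
    (g := fun x : ℝ => x) measurable_id (fun _ => ⟨0⟩)
  exact ⟨g, hg, fun x => congrFun h x⟩

/-- a measurable left inverse of the normal cdf -/
def Psi : ℝ → ℝ := Classical.choose exists_Psi

lemma Psi_meas : Measurable Psi := (Classical.choose_spec exists_Psi).1

lemma Psi_Phi (x : ℝ) : Psi (Phi x) = x := (Classical.choose_spec exists_Psi).2 x

lemma Psi_deriv (x : ℝ) : HasDerivAt Psi (ph x)⁻¹ (Phi x) :=
  ((Phi_deriv x).to_local_left_inverse (ph_pos x).ne' (Eventually.of_forall Psi_Phi)).hasDerivAt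

/-- unnormalised distribution function of the uniform law on `s` -/
def Fs (s : Set ℝ) (u : ℝ) : ℝ := ∫ t in Set.Iic u, s.indicator (fun _ => (1 : ℝ)) t

lemma Fs_eq {s : Set ℝ} (hs : IsOpen s) (u : ℝ) : Fs s u = volume.real (s ∩ Set.Iic u) := by
  unfold Fs
  rw [integral_indicator hs.measurableSet]
  simp [Measure.restrict_restrict hs.measurableSet]

lemma Fs_mono {s : Set ℝ} (hs : IsOpen s) {l : ℝ}
    (hvol : volume s = ENNReal.ofReal l) : Monotone (Fs s) := by
  intro u v huv
  rw [Fs_eq hs, Fs_eq hs]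
  refine measureReal_mono (Set.inter_subset_inter_right _ (Set.Iic_subset_Iic.2 huv)) ?_
  exact ((measure_mono Set.inter_subset_left).trans_lt (by rw [hvol]; exact ENNReal.ofReal_lt_top)).ne

lemma Fs_deriv {s : Set ℝ} (hs : IsOpen s) {l : ℝ}
    (hvol : volume s = ENNReal.ofReal l) {w : ℝ} (hw : w ∈ s) : HasDerivAt (Fs s) 1 w := by
  have hi : Integrable (s.indicator (fun _ => (1 : ℝ))) :=
    (integrable_indicator_iff hs.measurableSet).2
      (integrableOn_const (by rw [hvol]; exact ENNReal.ofReal_ne_top))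
  have hev : s.indicator (fun _ => (1 : ℝ)) =ᶠ[𝓝 w] fun _ => 1 := by
    filter_upwards [hs.mem_nhds hw] with t ht
    simp [ht]
  have hc : ContinuousAt (s.indicator (fun _ => (1 : ℝ))) w :=
    (continuousAt_const).congr hev.symm
  have := (hasStrictDerivAt_Iic hi hc).hasDerivAt
  rw [Set.indicator_of_mem hw] at this
  exact this

lemma Fs_range {s : Set ℝ} (hs : IsOpen s) {l : ℝ} (hl : 0 < l)
    (hvol : volume s = ENNReal.ofReal l) {w : ℝ} (hw : w ∈ s) : ∃ x, Phi x = Fs s w / l := by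
  have hfin : ∀ t, t ⊆ s → volume t ≠ ∞ := fun t ht =>
    ((measure_mono ht).trans_lt (by rw [hvol]; exact ENNReal.ofReal_lt_top)).ne
  have hreal : volume.real s = l := by
    rw [Measure.real, hvol, ENNReal.toReal_ofReal hl.le]
  obtain ⟨ε, hε, hb⟩ := Metric.isOpen_iff.1 hs w hw
  rw [Real.ball_eq_Ioo] at hb
  have h1 : ε ≤ Fs s w := by
    rw [Fs_eq hs]
    have : volume.real (Set.Ioo (w - ε) w) ≤ volume.real (s ∩ Set.Iic w) := by
      refine measureReal_mono (fun t ht => ⟨hb ⟨ht.1, ?_⟩, ht.2.le⟩) (hfin _ Set.inter_subset_left)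
      linarith [ht.2]
    rw [Real.volume_real_Ioo_of_le (by linarith)] at this
    linarith
  have h2 : Fs s w + ε ≤ l := by
    rw [Fs_eq hs]
    have : volume.real (Set.Ioo w (w + ε)) ≤ volume.real (s \ Set.Iic w) := by
      refine measureReal_mono (fun t ht => ⟨hb ⟨?_, ht.2⟩, not_le.2 ht.1⟩) (hfin _ Set.sdiff_subset)
      linarith [ht.1]
    rw [Real.volume_real_Ioo_of_le (by linarith)] at this
    have h3 := measureReal_inter_add_sdiff (μ := volume) (s := s) (t := Set.Iic w)
      measurableSet_Iic (hfin s subset_rfl)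
    linarith
  apply Phi_surj
  · exact div_pos (by linarith) hl
  · rw [div_lt_one hl]; linarith

lemma key1 {s : Set ℝ} (hs : IsOpen s) {l : ℝ} (hl : 0 < l)
    (hvol : volume s = ENNReal.ofReal l) (a b : ℝ) (ha : 0 < a) (hb : 0 ≤ b) (y : ℝ) :
    ∫⁻ w in s, ENNReal.ofReal (ph (a * (y - w) - b * Psi (Fs s w / l))
      * (a + b / (l * ph (Psi (Fs s w / l))))) ≤ 1 := by
  have hX : ∀ w ∈ s, Phi (Psi (Fs s w / l)) = Fs s w / l := by
    intro w hw
    obtain ⟨x, hx⟩ := Fs_range hs hl hvol hw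
    rw [← hx, Psi_Phi]
  have hder : ∀ w ∈ s, HasDerivWithinAt (fun w => a * (y - w) - b * Psi (Fs s w / l))
      (-(a + b / (l * ph (Psi (Fs s w / l))))) s w := by
    intro w hw
    have h1 := Psi_deriv (Psi (Fs s w / l))
    rw [hX w hw] at h1
    have h2 := (Fs_deriv hs hvol hw).div_const l
    have h3 := HasDerivAt.comp w h1 h2
    have h4 := (((hasDerivAt_id w).const_sub y).const_mul a).sub (h3.const_mul b)
    refine (h4.congr_deriv ?_).hasDerivWithinAt
    have := (ph_pos (Psi (Fs s w / l))).ne'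
    field_simp
    ring
  have hinj : Set.InjOn (fun w => a * (y - w) - b * Psi (Fs s w / l)) s := by
    have : StrictAntiOn (fun w => a * (y - w) - b * Psi (Fs s w / l)) s := by
      intro u hu v hv huv
      have h1 : Psi (Fs s u / l) ≤ Psi (Fs s v / l) := by
        rw [← Phi_strictMono.le_iff_le, hX u hu, hX v hv]
        have := Fs_mono hs hvol huv.le
        gcongr
      have := mul_le_mul_of_nonneg_left h1 hb
      have := mul_lt_mul_of_pos_left huv ha
      simp only
      linarith
    exact this.injOn
  have h := lintegral_image_eq_lintegral_abs_deriv_mul hs.measurableSet hder hinj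
    (fun t => ENNReal.ofReal (ph t))
  calc _ = ∫⁻ w in s, ENNReal.ofReal |-(a + b / (l * ph (Psi (Fs s w / l))))| *
        ENNReal.ofReal (ph (a * (y - w) - b * Psi (Fs s w / l))) := by
        refine lintegral_congr fun w => ?_
        have := ph_pos (Psi (Fs s w / l))
        rw [abs_neg, abs_of_nonneg (by positivity), ← ENNReal.ofReal_mul (by positivity), mul_comm]
    _ = _ := h.symm
    _ ≤ ∫⁻ t, ENNReal.ofReal (ph t) := setLIntegral_le_lintegral _ _
    _ = 1 := lintegral_ph

end MimoOptical

namespace MimoOptical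

/-! ### The multi-dimensional estimate -/

lemma log_concave {t x y : ℝ} (h0 : 0 < t) (h1 : t < 1) (hx : 0 < x) (hy : 0 < y) :
    t * Real.log x + (1 - t) * Real.log y ≤ Real.log (t * x + (1 - t) * y) := by
  have := strictConcaveOn_log_Ioi.concaveOn.2 (Set.mem_Ioi.2 hx) (Set.mem_Ioi.2 hy) h0.le
    (by linarith : 0 ≤ 1 - t) (by ring)
  simpa using this

lemma measurePreserving_cons (m : ℕ) :
    MeasurePreserving (fun p : ℝ × (Fin m → ℝ) => (Fin.cons p.1 p.2 : Fin (m + 1) → ℝ)) := by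
  have h := (volume_preserving_piFinSuccAbove (fun _ : Fin (m + 1) => ℝ) 0).symm
  convert h using 1
  funext p
  simp [MeasurableEquiv.piFinSuccAbove, Fin.insertNthEquiv]

lemma lintegral_cons (m : ℕ) {g : (Fin (m + 1) → ℝ) → ℝ≥0∞} (hg : Measurable g) :
    ∫⁻ w, g w = ∫⁻ r : Fin m → ℝ, ∫⁻ t : ℝ, g (Fin.cons t r) := by
  have h := measurePreserving_cons m
  rw [← h.lintegral_comp hg, Measure.volume_eq_prod]
  exact lintegral_prod_symm (fun p : ℝ × (Fin m → ℝ) => g (Fin.cons p.1 p.2))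
    (hg.comp h.measurable).aemeasurable

/-- one-dimensional slice -/
def slice {m : ℕ} (S : Set (Fin (m + 1) → ℝ)) (r : Fin m → ℝ) : Set ℝ :=
  {t | (Fin.cons t r : Fin (m + 1) → ℝ) ∈ S}

lemma slice_open {m : ℕ} {S : Set (Fin (m + 1) → ℝ)} (hS : IsOpen S) (r : Fin m → ℝ) :
    IsOpen (slice S r) := by
  refine hS.preimage (f := fun t : ℝ => (Fin.cons t r : Fin (m + 1) → ℝ)) ?_
  fun_prop

/-- length of a slice -/
def len {m : ℕ} (S : Set (Fin (m + 1) → ℝ)) (r : Fin m → ℝ) : ℝ := volume.real (slice S r)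

lemma len_meas {m : ℕ} {S : Set (Fin (m + 1) → ℝ)} (hS : IsOpen S) : Measurable (len S) := by
  have hm : MeasurableSet {p : (Fin m → ℝ) × ℝ | (Fin.cons p.2 p.1 : Fin (m + 1) → ℝ) ∈ S} := by
    refine (hS.preimage (f := fun p : (Fin m → ℝ) × ℝ =>
      (Fin.cons p.2 p.1 : Fin (m + 1) → ℝ)) ?_).measurableSet
    fun_prop
  exact (measurable_measure_prodMk_left (ν := (volume : Measure ℝ)) hm).ennreal_toReal

/-- the Gaussianising coordinate -/
def Xc {m : ℕ} (S : Set (Fin (m + 1) → ℝ)) (w : Fin (m + 1) → ℝ) : ℝ :=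
  Psi (Fs (slice S (Fin.tail w)) (w 0) / len S (Fin.tail w))

lemma tail_meas (m : ℕ) : Measurable (fun w : Fin (m + 1) → ℝ => Fin.tail w) := by
  unfold Fin.tail; fun_prop

lemma Xc_meas {m : ℕ} {S : Set (Fin (m + 1) → ℝ)} (hS : IsOpen S) : Measurable (Xc S) := by
  unfold Xc
  refine Psi_meas.comp (Measurable.div ?_ ((len_meas hS).comp (tail_meas m)))
  simp_rw [Fs_eq (slice_open hS _)]
  have hm : MeasurableSet {p : (Fin (m + 1) → ℝ) × ℝ |
      (Fin.cons p.2 (Fin.tail p.1) : Fin (m + 1) → ℝ) ∈ S ∧ p.2 ≤ p.1 0} := by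
    refine MeasurableSet.inter ((hS.preimage (f := fun p : (Fin (m + 1) → ℝ) × ℝ =>
      (Fin.cons p.2 (Fin.tail p.1) : Fin (m + 1) → ℝ)) ?_).measurableSet) ?_
    · unfold Fin.tail; fun_prop
    · exact measurableSet_le (f := fun p : (Fin (m + 1) → ℝ) × ℝ => p.2)
        (g := fun p : (Fin (m + 1) → ℝ) × ℝ => p.1 0) (by fun_prop) (by fun_prop)
  exact (measurable_measure_prodMk_left (ν := (volume : Measure ℝ)) hm).ennreal_toReal

/-- transport kernel -/
def Kk {m : ℕ} (S : Set (Fin (m + 1) → ℝ)) (a b : ℝ) (w : Fin (m + 1) → ℝ) (z : ℝ) : ℝ :=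
  ph (a * z - b * Xc S w) * (a + b / (len S (Fin.tail w) * ph (Xc S w)))

/-- mixed transport kernel -/
def Nk {m : ℕ} (S : Set (Fin (m + 1) → ℝ)) (V a b : ℝ) (w z : Fin (m + 1) → ℝ) : ℝ :=
  (a ^ 2 * phn m (Fin.tail z) + (1 - a ^ 2) * (len S (Fin.tail w) / V)) * Kk S a b w (z 0)

lemma Nk_meas {m : ℕ} {S : Set (Fin (m + 1) → ℝ)} (hS : IsOpen S) (V a b : ℝ) :
    Measurable (fun p : (Fin (m + 1) → ℝ) × (Fin (m + 1) → ℝ) => Nk S V a b p.1 p.2) := by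
  unfold Nk Kk
  have h1 := Xc_meas hS
  have h2 := len_meas hS
  have h3 := tail_meas m
  have h4 := phn_meas m
  have h5 := ph_meas
  fun_prop

lemma Kk_int {m : ℕ} {S : Set (Fin (m + 1) → ℝ)} (hS : IsOpen S)
    (hfin : ∀ r, volume (slice S r) ≠ ∞) (a b : ℝ) (ha : 0 < a) (hb : 0 ≤ b)
    (r : Fin m → ℝ) (y : ℝ) :
    ∫⁻ t in slice S r, ENNReal.ofReal (Kk S a b (Fin.cons t r) (y - t)) ≤ 1 := by
  rcases (slice S r).eq_empty_or_nonempty with h | h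
  · rw [h]; simp
  · have hpos : 0 < len S r := by
      refine ENNReal.toReal_pos ?_ (hfin r)
      exact ((slice_open hS r).measure_pos volume h).ne'
    have hv : volume (slice S r) = ENNReal.ofReal (len S r) :=
      (ENNReal.ofReal_toReal (hfin r)).symm
    have := key1 (slice_open hS r) hpos hv a b ha hb y
    simpa [Kk, Xc] using this

lemma Nk_int {m : ℕ} {S : Set (Fin (m + 1) → ℝ)} (hS : IsOpen S)
    (hfin : ∀ r, volume (slice S r) ≠ ∞) {V : ℝ} (hV : 0 < V) (hvol : volume S = ENNReal.ofReal V)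
    (a b : ℝ) (ha : 0 < a) (ha1 : a ≤ 1) (hb : 0 ≤ b) (y : Fin (m + 1) → ℝ) :
    ∫⁻ w in S, ENNReal.ofReal (Nk S V a b w (y - w)) ≤ 1 := by
  have ha2 : 0 ≤ 1 - a ^ 2 := by nlinarith
  have hlen : ∀ r, 0 ≤ len S r := fun r => measureReal_nonneg
  have hN := Nk_meas hS V a b
  have hNy : Measurable (fun w => ENNReal.ofReal (Nk S V a b w (y - w))) := by
    have h0 : Measurable (fun w : Fin (m + 1) → ℝ => (w, y - w)) := by fun_prop
    have h1 := (hN.comp h0).ennreal_ofReal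
    exact h1
  have hlv : ∫⁻ r : Fin m → ℝ, ENNReal.ofReal (len S r) = ENNReal.ofReal V := by
    rw [← hvol, ← lintegral_indicator_one hS.measurableSet,
      lintegral_cons m (measurable_one.indicator hS.measurableSet)]
    refine lintegral_congr fun r => ?_
    have : (fun t : ℝ => S.indicator (1 : (Fin (m + 1) → ℝ) → ℝ≥0∞) (Fin.cons t r))
      = (slice S r).indicator 1 := by
      funext t
      by_cases ht : t ∈ slice S r
      · rw [Set.indicator_of_mem ht, Set.indicator_of_mem (show _ ∈ S from ht)]; rfl
      · rw [Set.indicator_of_notMem ht, Set.indicator_of_notMem (show _ ∉ S from ht)]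
    rw [this, lintegral_indicator_one (slice_open hS r).measurableSet]
    exact ENNReal.ofReal_toReal (hfin r)
  have hph : ∫⁻ r : Fin m → ℝ, ENNReal.ofReal (phn m (Fin.tail y - r)) = 1 := by
    rw [lintegral_sub_left_eq_self (fun r => ENNReal.ofReal (phn m r)), lintegral_phn]
  rw [← lintegral_indicator hS.measurableSet, lintegral_cons m (hNy.indicator hS.measurableSet)]
  calc _ = ∫⁻ r : Fin m → ℝ, ENNReal.ofReal
          (a ^ 2 * phn m (Fin.tail y - r) + (1 - a ^ 2) * (len S r / V)) *
        ∫⁻ t in slice S r, ENNReal.ofReal (Kk S a b (Fin.cons t r) (y 0 - t)) := by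
        refine lintegral_congr fun r => ?_
        rw [← lintegral_const_mul', ← lintegral_indicator (slice_open hS r).measurableSet]
        · refine lintegral_congr fun t => ?_
          by_cases ht : t ∈ slice S r
          · rw [Set.indicator_of_mem ht, Set.indicator_of_mem (show _ ∈ S from ht)]
            rw [← ENNReal.ofReal_mul]
            · congr 1
            · have := phn_pos m (Fin.tail y - r)
              have := hlen r
              positivity
          · rw [Set.indicator_of_notMem ht, Set.indicator_of_notMem (show _ ∉ S from ht)]
        · exact ENNReal.ofReal_ne_top
    _ ≤ ∫⁻ r : Fin m → ℝ, ENNReal.ofReal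
          (a ^ 2 * phn m (Fin.tail y - r) + (1 - a ^ 2) * (len S r / V)) := by
        refine lintegral_mono fun r => ?_
        refine (mul_le_mul_right (Kk_int hS hfin a b ha hb r (y 0)) _).trans ?_
        rw [mul_one]
    _ = ∫⁻ r : Fin m → ℝ, (ENNReal.ofReal (a ^ 2) * ENNReal.ofReal (phn m (Fin.tail y - r))
          + ENNReal.ofReal ((1 - a ^ 2) / V) * ENNReal.ofReal (len S r)) := by
        refine lintegral_congr fun r => ?_
        have := phn_pos m (Fin.tail y - r)
        have := hlen r
        rw [← ENNReal.ofReal_mul (by positivity), ← ENNReal.ofReal_mul (by positivity),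
          ← ENNReal.ofReal_add (by positivity) (by positivity)]
        congr 1; ring
    _ = 1 := by
        have hm1 : Measurable fun r : Fin m → ℝ => ENNReal.ofReal (phn m (Fin.tail y - r)) :=
          ((phn_meas m).comp (measurable_const.sub measurable_id)).ennreal_ofReal
        rw [lintegral_add_left (hm1.const_mul _), lintegral_const_mul _ hm1,
          lintegral_const_mul _ (len_meas hS).ennreal_ofReal, hph, hlv, mul_one,
          ← ENNReal.ofReal_mul (by positivity), div_mul_cancel₀ _ hV.ne',
          ← ENNReal.ofReal_add (by positivity) ha2]
        simp

lemma pointwise_bound {m : ℕ} {S : Set (Fin (m + 1) → ℝ)} (hS : IsOpen S)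
    (hfin : ∀ r, volume (slice S r) ≠ ∞) {V : ℝ} (hV : 0 < V)
    (a b : ℝ) (ha : 0 < a) (hb : 0 < b) (hab : a ^ 2 + b ^ 2 = 1)
    {w : Fin (m + 1) → ℝ} (hw : w ∈ S) (z : Fin (m + 1) → ℝ) {P : ℝ} (hP : 0 < P) :
    Real.log P ≤ P * Nk S V a b w z / phn (m + 1) z
      + (-1 + (a ^ 2 * Real.log a + b ^ 2 * Real.log b)
        + b ^ 2 * (Real.log (phn (m + 1) z) + Real.log V) - a * b * Xc S w * z 0) := by
  have hl : 0 < len S (Fin.tail w) := by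
    refine ENNReal.toReal_pos ?_ (hfin _)
    refine ((slice_open hS _).measure_pos volume ⟨w 0, ?_⟩).ne'
    simpa [slice] using hw
  have hb2 : 1 - a ^ 2 = b ^ 2 := by linarith
  have ha1 : a ^ 2 < 1 := by nlinarith
  unfold Nk Kk
  set l := len S (Fin.tail w)
  set X := Xc S w
  have hX := ph_pos X
  have hy := ph_pos (a * z 0 - b * X)
  have hm := phn_pos m (Fin.tail z)
  have hz := phn_pos (m + 1) z
  have e1 := log_concave (t := a ^ 2) (by positivity) ha1 hm (div_pos hl hV)
  rw [Real.log_div hl.ne' hV.ne'] at e1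
  have e2 := log_concave (t := a ^ 2) (by positivity) ha1 (inv_pos.2 ha)
    (inv_pos.2 (mul_pos hb (mul_pos hl hX)))
  rw [Real.log_inv, Real.log_inv, Real.log_mul hb.ne' (mul_pos hl hX).ne',
    Real.log_mul hl.ne' hX.ne', log_ph] at e2
  have e3 : a ^ 2 * a⁻¹ + (1 - a ^ 2) * (b * (l * ph X))⁻¹ = a + b / (l * ph X) := by
    rw [hb2]; field_simp
  rw [e3] at e2
  have hA : 0 < a ^ 2 * phn m (Fin.tail z) + (1 - a ^ 2) * (l / V) := by
    rw [hb2]; positivity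
  have hD : 0 < a + b / (l * ph X) := by positivity
  set D := a + b / (l * ph X)
  set A := a ^ 2 * phn m (Fin.tail z) + (1 - a ^ 2) * (l / V)
  have e4 := Real.log_le_sub_one_of_pos
    (show 0 < P * (A * (ph (a * z 0 - b * X) * D)) / phn (m + 1) z by positivity)
  rw [Real.log_div (by positivity) hz.ne', Real.log_mul hP.ne' (by positivity),
    Real.log_mul hA.ne' (by positivity), Real.log_mul hy.ne' hD.ne', log_ph] at e4
  have e5 : Real.log (phn (m + 1) z) = Real.log (phn m (Fin.tail z)) + Real.log (ph (z 0)) := by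
    rw [← Real.log_mul hm.ne' (ph_pos _).ne']
    congr 1
    simp [phn, Fin.prod_univ_succ, Fin.tail, mul_comm]
  rw [log_ph] at e5
  have e6 : (a * z 0 - b * X) ^ 2 = a ^ 2 * z 0 ^ 2 + b ^ 2 * X ^ 2 - 2 * a * b * X * z 0 := by ring
  rw [e6] at e4
  rw [hb2] at e1 e2
  have ha' : a ^ 2 = 1 - b ^ 2 := by linarith
  rw [e5] at e4 ⊢
  generalize Real.log (phn m (Fin.tail z)) = L1 at *
  generalize Real.log P = LP at *
  generalize Real.log A = LA at *
  generalize Real.log D = LD at *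
  generalize Real.log l = Ll at *
  generalize Real.log V = LV at *
  generalize Real.log (2 * Real.pi) = c at *
  generalize Real.log a = La at *
  generalize Real.log b = Lb at *
  generalize P * (A * (ph (a * z 0 - b * X) * D)) / phn (m + 1) z = RR at *
  have hq : a ^ 2 * z 0 ^ 2 = z 0 ^ 2 - b ^ 2 * z 0 ^ 2 := by rw [ha']; ring
  have hq1 : a ^ 2 * L1 = L1 - b ^ 2 * L1 := by rw [ha']; ring
  linarith

lemma key_nd {m : ℕ} {S : Set (Fin (m + 1) → ℝ)} (hS : IsOpen S)
    (hfin : ∀ r, volume (slice S r) ≠ ∞) {V : ℝ} (hV : 0 < V) (hvol : volume S = ENNReal.ofReal V)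
    (a b : ℝ) (ha : 0 < a) (hb : 0 < b) (hab : a ^ 2 + b ^ 2 = 1)
    {P : (Fin (m + 1) → ℝ) → ℝ} (hPm : Measurable P) (hP : ∀ y, 0 < P y)
    (hPi : ∫⁻ y, ENNReal.ofReal (P y) ≤ ENNReal.ofReal V)
    (hIntg : Integrable (fun p : (Fin (m + 1) → ℝ) × (Fin (m + 1) → ℝ) => Real.log (P (p.1 + p.2)))
      ((volume.restrict S).prod (stdGaussian (m + 1)))) :
    ∫ p, Real.log (P (p.1 + p.2)) ∂((volume.restrict S).prod (stdGaussian (m + 1)))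
      ≤ V * ((a ^ 2 * Real.log a + b ^ 2 * Real.log b)
        + b ^ 2 * (-((m + 1 : ℕ) / 2 * Real.log (2 * Real.pi * Real.exp 1)) + Real.log V)) := by
  have : IsFiniteMeasure (volume.restrict S) := ⟨by
    rw [Measure.restrict_apply_univ, hvol]; exact ENNReal.ofReal_lt_top⟩
  have ha1 : a ≤ 1 := by nlinarith
  have hb2 : 0 ≤ 1 - a ^ 2 := by nlinarith
  have hNm := Nk_meas hS V a b
  have hN0 : ∀ w z, 0 ≤ Nk S V a b w z := by
    intro w z
    unfold Nk Kk
    have h1 := phn_pos m (Fin.tail z)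
    have h2 : 0 ≤ len S (Fin.tail w) := measureReal_nonneg
    have h3 := ph_pos (Xc S w)
    have h4 := ph_pos (a * z 0 - b * Xc S w)
    positivity
  set R : (Fin (m + 1) → ℝ) × (Fin (m + 1) → ℝ) → ℝ :=
    fun p => P (p.1 + p.2) * Nk S V a b p.1 p.2 / phn (m + 1) p.2 with hR
  have hRm : Measurable R := by
    have := phn_meas (m + 1)
    fun_prop
  have hR0 : ∀ p, 0 ≤ R p := fun p =>
    div_nonneg (mul_nonneg (hP _).le (hN0 _ _)) (phn_pos _ _).le
  have hRint : ∫⁻ p, ENNReal.ofReal (R p) ∂((volume.restrict S).prod (stdGaussian (m + 1)))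
      ≤ ENNReal.ofReal V := by
    rw [lintegral_prod _ hRm.ennreal_ofReal.aemeasurable]
    calc _ = ∫⁻ w in S, ∫⁻ y, ENNReal.ofReal (P y) * ENNReal.ofReal (Nk S V a b w (y - w)) := by
          refine lintegral_congr fun w => ?_
          rw [lintegral_stdGaussian _ (by fun_prop)]
          rw [← lintegral_add_right_eq_self (fun y => ENNReal.ofReal (P y) *
            ENNReal.ofReal (Nk S V a b w (y - w))) w]
          refine lintegral_congr fun z => ?_
          rw [← ENNReal.ofReal_mul (phn_pos _ _).le, ← ENNReal.ofReal_mul (hP _).le]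
          congr 1
          simp only [hR]
          rw [add_sub_cancel_right, mul_div_cancel₀ _ (phn_pos _ _).ne', add_comm z w]
      _ = ∫⁻ y, ∫⁻ w in S, ENNReal.ofReal (P y) * ENNReal.ofReal (Nk S V a b w (y - w)) := by
          refine lintegral_lintegral_swap ?_
          refine Measurable.aemeasurable ?_
          refine Measurable.mul (hPm.comp measurable_snd).ennreal_ofReal ?_
          exact (hNm.comp (measurable_fst.prodMk
            (measurable_snd.sub measurable_fst))).ennreal_ofReal
      _ ≤ ∫⁻ y, ENNReal.ofReal (P y) := by
          refine lintegral_mono fun y => ?_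
          rw [lintegral_const_mul' _ _ ENNReal.ofReal_ne_top]
          refine (mul_le_mul_right (Nk_int hS hfin hV hvol a b ha ha1 hb.le y) _).trans ?_
          rw [mul_one]
      _ ≤ _ := hPi
  have hRI : Integrable R ((volume.restrict S).prod (stdGaussian (m + 1))) := by
    refine ⟨hRm.aestronglyMeasurable, ?_⟩
    rw [hasFiniteIntegral_iff_ofReal (ae_of_all _ hR0)]
    exact hRint.trans_lt ENNReal.ofReal_lt_top
  have hRV : ∫ p, R p ∂((volume.restrict S).prod (stdGaussian (m + 1))) ≤ V := by
    rw [integral_eq_lintegral_of_nonneg_ae (ae_of_all _ hR0) hRm.aestronglyMeasurable]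
    exact ENNReal.toReal_le_of_le_ofReal hV.le hRint
  rw [integral_prod _ hRI] at hRV
  rw [integral_prod _ hIntg]
  set C : ℝ := -1 + (a ^ 2 * Real.log a + b ^ 2 * Real.log b)
    + b ^ 2 * (-((m + 1 : ℕ) / 2 * Real.log (2 * Real.pi * Real.exp 1)) + Real.log V) with hC
  have hreal : volume.real S = V := by
    rw [Measure.real, hvol, ENNReal.toReal_ofReal hV.le]
  have hstep : ∀ᵐ w ∂(volume.restrict S),
      ∫ z, Real.log (P (w + z)) ∂(stdGaussian (m + 1))
        ≤ (∫ z, R (w, z) ∂(stdGaussian (m + 1))) + C := by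
    filter_upwards [hRI.prod_right_ae, hIntg.prod_right_ae, ae_restrict_mem hS.measurableSet]
      with w h1 h2 hw
    have hi1 := integrable_log_phn (m + 1)
    have hi2 := integrable_std_eval (m + 1) 0
    have hi3 : Integrable (fun z => b ^ 2 * (Real.log (phn (m + 1) z) + Real.log V))
        (stdGaussian (m + 1)) := (hi1.add (integrable_const _)).const_mul _
    have hi4 : Integrable (fun z : Fin (m + 1) → ℝ => a * b * Xc S w * z 0)
        (stdGaussian (m + 1)) := hi2.const_mul _
    have hi5 : Integrable (fun z : Fin (m + 1) → ℝ =>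
        -1 + (a ^ 2 * Real.log a + b ^ 2 * Real.log b)
        + b ^ 2 * (Real.log (phn (m + 1) z) + Real.log V)) (stdGaussian (m + 1)) :=
      (integrable_const _).add hi3
    have hle := integral_mono h2 (h1.add (hi5.sub hi4))
      (fun z => pointwise_bound hS hfin hV a b ha hb hab hw z (hP (w + z)))
    refine hle.trans (le_of_eq ?_)
    rw [integral_add' h1 (hi5.sub hi4), integral_sub' hi5 hi4, integral_const_mul,
      integral_std_eval, integral_add (integrable_const _) hi3, integral_const_mul,
      integral_add hi1 (integrable_const _), integral_log_phn]
    simp [hC]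
  have hfi := integral_mono_ae hIntg.integral_prod_left
    (hRI.integral_prod_left.add (integrable_const C)) hstep
  refine hfi.trans ?_
  rw [integral_add' hRI.integral_prod_left (integrable_const C), integral_const]
  rw [measureReal_restrict_apply_univ, hreal, smul_eq_mul]
  have : V * C = -V + V * ((a ^ 2 * Real.log a + b ^ 2 * Real.log b)
        + b ^ 2 * (-((m + 1 : ℕ) / 2 * Real.log (2 * Real.pi * Real.exp 1)) + Real.log V)) := by
    rw [hC]; ring
  linarith

end MimoOptical

namespace MimoOptical

/-! ### Mutual information of the channel -/

/-- output density -/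
def fY {nt nr : ℕ} (H : Matrix (Fin nr) (Fin nt) ℝ) (μ : Measure (Fin nt → ℝ))
    (y : Fin nr → ℝ) : ℝ :=
  ∫ x, phn nr (y - H.mulVec x) ∂μ

lemma mulVec_cont {nt nr : ℕ} (H : Matrix (Fin nr) (Fin nt) ℝ) :
    Continuous (fun x : Fin nt → ℝ => H.mulVec x) :=
  (Matrix.mulVecLin H).continuous_of_finiteDimensional

lemma ker_cont {nt nr : ℕ} (H : Matrix (Fin nr) (Fin nt) ℝ) :
    Continuous (fun p : (Fin nt → ℝ) × (Fin nr → ℝ) => phn nr (p.2 - H.mulVec p.1)) :=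
  (phn_cont nr).comp (continuous_snd.sub ((mulVec_cont H).comp continuous_fst))

lemma ker_integrable {nt nr : ℕ} (H : Matrix (Fin nr) (Fin nt) ℝ) (μ : Measure (Fin nt → ℝ))
    [IsProbabilityMeasure μ] (y : Fin nr → ℝ) :
    Integrable (fun x => phn nr (y - H.mulVec x)) μ := by
  refine Integrable.of_bound (C := phn nr 0) ?_ (ae_of_all _ fun x => ?_)
  · exact ((phn_cont nr).comp
      (continuous_const.sub (mulVec_cont H))).measurable.aestronglyMeasurable
  · rw [Real.norm_eq_abs, abs_of_pos (phn_pos _ _)]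
    exact phn_le _ _

lemma fY_pos {nt nr : ℕ} (H : Matrix (Fin nr) (Fin nt) ℝ) (μ : Measure (Fin nt → ℝ))
    [IsProbabilityMeasure μ] (y : Fin nr → ℝ) : 0 < fY H μ y := by
  unfold fY
  rw [integral_pos_iff_support_of_nonneg (fun x => (phn_pos _ _).le) (ker_integrable H μ y)]
  have : Function.support (fun x => phn nr (y - H.mulVec x)) = Set.univ := by
    ext x; simp [(phn_pos nr (y - H.mulVec x)).ne']
  rw [this]; simp

lemma fY_le {nt nr : ℕ} (H : Matrix (Fin nr) (Fin nt) ℝ) (μ : Measure (Fin nt → ℝ))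
    [IsProbabilityMeasure μ] (y : Fin nr → ℝ) : fY H μ y ≤ phn nr 0 := by
  have := integral_mono (ker_integrable H μ y) (integrable_const (phn nr 0))
    (fun x => phn_le nr (y - H.mulVec x))
  simpa [fY] using this

lemma fY_meas {nt nr : ℕ} (H : Matrix (Fin nr) (Fin nt) ℝ) (μ : Measure (Fin nt → ℝ))
    [IsProbabilityMeasure μ] : Measurable (fY H μ) := by
  unfold fY
  have h : StronglyMeasurable (fun p : (Fin nr → ℝ) × (Fin nt → ℝ) =>
      phn nr (p.1 - H.mulVec p.2)) :=
    ((phn_cont nr).comp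
      (continuous_fst.sub ((mulVec_cont H).comp continuous_snd))).stronglyMeasurable
  exact h.integral_prod_right.measurable

lemma ofReal_fY {nt nr : ℕ} (H : Matrix (Fin nr) (Fin nt) ℝ) (μ : Measure (Fin nt → ℝ))
    [IsProbabilityMeasure μ] (y : Fin nr → ℝ) :
    ENNReal.ofReal (fY H μ y) = ∫⁻ x, ENNReal.ofReal (phn nr (y - H.mulVec x)) ∂μ :=
  ofReal_integral_eq_lintegral_ofReal (ker_integrable H μ y)
    (ae_of_all _ fun x => (phn_pos _ _).le)

lemma joint_map_meas {nt nr : ℕ} (H : Matrix (Fin nr) (Fin nt) ℝ) :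
    Measurable (fun p : (Fin nt → ℝ) × (Fin nr → ℝ) => (p.1, H.mulVec p.1 + p.2)) :=
  measurable_fst.prodMk
    (((mulVec_cont H).measurable.comp measurable_fst).add measurable_snd)

lemma joint_lintegral {nt nr : ℕ} (H : Matrix (Fin nr) (Fin nt) ℝ) (μ : Measure (Fin nt → ℝ))
    [IsProbabilityMeasure μ] {g : (Fin nt → ℝ) × (Fin nr → ℝ) → ℝ≥0∞} (hg : Measurable g) :
    ∫⁻ p, g p ∂(jointLaw H μ)
      = ∫⁻ x, ∫⁻ y, ENNReal.ofReal (phn nr (y - H.mulVec x)) * g (x, y) ∂volume ∂μ := by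
  unfold jointLaw
  rw [lintegral_map hg (joint_map_meas H)]
  refine (lintegral_prod (fun p => g (p.1, H.mulVec p.1 + p.2))
    (hg.comp (joint_map_meas H)).aemeasurable).trans ?_
  refine lintegral_congr fun x => ?_
  have hgx : Measurable (fun z => g (x, H.mulVec x + z)) :=
    hg.comp (measurable_const.prodMk (measurable_const.add measurable_id))
  rw [lintegral_stdGaussian _ hgx]
  rw [← lintegral_add_left_eq_self
    (fun y => ENNReal.ofReal (phn nr (y - H.mulVec x)) * g (x, y)) (H.mulVec x)]
  simp

lemma joint_fst {nt nr : ℕ} (H : Matrix (Fin nr) (Fin nt) ℝ) (μ : Measure (Fin nt → ℝ))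
    [IsProbabilityMeasure μ] : (jointLaw H μ).map Prod.fst = μ := by
  unfold jointLaw
  rw [Measure.map_map measurable_fst (joint_map_meas H)]
  have : (Prod.fst ∘ fun p : (Fin nt → ℝ) × (Fin nr → ℝ) => (p.1, H.mulVec p.1 + p.2))
    = Prod.fst := rfl
  rw [this]
  simp

lemma joint_snd {nt nr : ℕ} (H : Matrix (Fin nr) (Fin nt) ℝ) (μ : Measure (Fin nt → ℝ))
    [IsProbabilityMeasure μ] :
    (jointLaw H μ).map Prod.snd = volume.withDensity fun y => ENNReal.ofReal (fY H μ y) := by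
  refine Measure.ext_of_lintegral _ fun g hg => ?_
  rw [lintegral_map hg measurable_snd, joint_lintegral H μ (g := fun p => g p.2) (hg.comp measurable_snd),
    lintegral_withDensity_eq_lintegral_mul _ (fY_meas H μ).ennreal_ofReal hg,
    lintegral_lintegral_swap]
  · refine lintegral_congr fun y => ?_
    have hm : Measurable (fun x => ENNReal.ofReal (phn nr (y - H.mulVec x))) :=
      ((phn_cont nr).comp
        (continuous_const.sub (mulVec_cont H))).measurable.ennreal_ofReal
    simp only [Pi.mul_apply]
    rw [lintegral_mul_const _ hm, ofReal_fY]
  · exact ((ker_cont H).measurable.ennreal_ofReal.mul (hg.comp measurable_snd)).aemeasurable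

lemma joint_withDensity {nt nr : ℕ} (H : Matrix (Fin nr) (Fin nt) ℝ) (μ : Measure (Fin nt → ℝ))
    [IsProbabilityMeasure μ] :
    jointLaw H μ = (μ.prod (volume.withDensity fun y => ENNReal.ofReal (fY H μ y))).withDensity
      (fun p => ENNReal.ofReal (phn nr (p.2 - H.mulVec p.1) / fY H μ p.2)) := by
  have hd : Measurable (fun p : (Fin nt → ℝ) × (Fin nr → ℝ) =>
      ENNReal.ofReal (phn nr (p.2 - H.mulVec p.1) / fY H μ p.2)) :=
    ((ker_cont H).measurable.div ((fY_meas H μ).comp measurable_snd)).ennreal_ofReal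
  refine Measure.ext_of_lintegral _ fun g hg => ?_
  rw [joint_lintegral H μ hg, lintegral_withDensity_eq_lintegral_mul _ hd hg,
    lintegral_prod _ (hd.mul hg).aemeasurable]
  refine lintegral_congr fun x => ?_
  have hx : Measurable (fun y : Fin nr → ℝ => (x, y)) := measurable_const.prodMk measurable_id
  have h := lintegral_withDensity_eq_lintegral_mul volume (fY_meas H μ).ennreal_ofReal
    ((hd.mul hg).comp hx)
  refine Eq.trans ?_ h.symm
  refine lintegral_congr fun y => ?_
  simp only [Pi.mul_apply, Function.comp]
  rw [← mul_assoc, ← ENNReal.ofReal_mul (fY_pos H μ y).le, mul_div_cancel₀ _ (fY_pos H μ y).ne']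

lemma info_eq {nt nr : ℕ} (H : Matrix (Fin nr) (Fin nt) ℝ) (μ : Measure (Fin nt → ℝ))
    [IsProbabilityMeasure μ] :
    mutualInfoJoint (jointLaw H μ)
      = ∫ p, (Real.log (phn nr p.2) - Real.log (fY H μ (H.mulVec p.1 + p.2)))
          ∂(μ.prod (stdGaussian nr)) := by
  have hd : Measurable (fun p : (Fin nt → ℝ) × (Fin nr → ℝ) =>
      ENNReal.ofReal (phn nr (p.2 - H.mulVec p.1) / fY H μ p.2)) :=
    ((ker_cont H).measurable.div ((fY_meas H μ).comp measurable_snd)).ennreal_ofReal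
  unfold mutualInfoJoint klDivR
  rw [joint_fst, joint_snd]
  set ν := μ.prod (volume.withDensity fun y => ENNReal.ofReal (fY H μ y)) with hν
  have hae : ∀ᵐ p ∂(jointLaw H μ), (jointLaw H μ).rnDeriv ν p
      = ENNReal.ofReal (phn nr (p.2 - H.mulVec p.1) / fY H μ p.2) := by
    have h1 := Measure.rnDeriv_withDensity ν hd
    rw [← joint_withDensity H μ] at h1
    have h2 : jointLaw H μ ≪ ν := by
      rw [joint_withDensity H μ]; exact withDensity_absolutelyContinuous _ _
    exact h2.ae_le h1
  have hmeas : Measurable (fun p : (Fin nt → ℝ) × (Fin nr → ℝ) =>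
      Real.log (phn nr (p.2 - H.mulVec p.1)) - Real.log (fY H μ p.2)) :=
    (Real.measurable_log.comp (ker_cont H).measurable).sub
      (Real.measurable_log.comp ((fY_meas H μ).comp measurable_snd))
  calc _ = ∫ p, (Real.log (phn nr (p.2 - H.mulVec p.1)) - Real.log (fY H μ p.2))
        ∂(jointLaw H μ) := by
        refine integral_congr_ae ?_
        filter_upwards [hae] with p hp
        have h1 := phn_pos nr (p.2 - H.mulVec p.1)
        have h2 := fY_pos H μ p.2
        rw [hp, ENNReal.toReal_ofReal (div_pos h1 h2).le, Real.log_div h1.ne' h2.ne']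
    _ = _ := by
        unfold jointLaw
        rw [integral_map (joint_map_meas H).aemeasurable hmeas.aestronglyMeasurable]
        simp

/-- a bound on the spread of `H x` -/
def Dbd {nt nr : ℕ} (H : Matrix (Fin nr) (Fin nt) ℝ) (A : ℝ) : ℝ := A * ∑ i, ∑ j, |H i j|

lemma Dbd_bound {nt nr : ℕ} (H : Matrix (Fin nr) (Fin nt) ℝ) {A : ℝ} (hA : 0 < A)
    {x x' : Fin nt → ℝ} (hx : ∀ k, x k ∈ Set.Icc (0 : ℝ) A) (hx' : ∀ k, x' k ∈ Set.Icc (0 : ℝ) A)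
    (i : Fin nr) : |H.mulVec x i - H.mulVec x' i| ≤ Dbd H A := by
  simp only [Matrix.mulVec, dotProduct, ← Finset.sum_sub_distrib, ← mul_sub]
  refine (Finset.abs_sum_le_sum_abs _ _).trans ?_
  calc ∑ j, |H i j * (x j - x' j)| ≤ ∑ j, A * |H i j| := by
        refine Finset.sum_le_sum fun j _ => ?_
        rw [abs_mul, mul_comm]
        refine mul_le_mul_of_nonneg_right ?_ (abs_nonneg _)
        rw [abs_le]
        exact ⟨by linarith [(hx j).1, (hx' j).2], by linarith [(hx j).2, (hx' j).1]⟩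
    _ = A * ∑ j, |H i j| := by rw [Finset.mul_sum]
    _ ≤ Dbd H A := by
        unfold Dbd
        refine mul_le_mul_of_nonneg_left ?_ hA.le
        exact Finset.single_le_sum (f := fun i => ∑ j, |H i j|)
          (fun i _ => Finset.sum_nonneg fun j _ => abs_nonneg _) (Finset.mem_univ i)

lemma fY_lower {nt nr : ℕ} (H : Matrix (Fin nr) (Fin nt) ℝ) (μ : Measure (Fin nt → ℝ))
    [IsProbabilityMeasure μ] {A : ℝ} (hA : 0 < A)
    (hsupp : ∀ᵐ x ∂μ, ∀ k, x k ∈ Set.Icc (0 : ℝ) A) {x : Fin nt → ℝ}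
    (hx : ∀ k, x k ∈ Set.Icc (0 : ℝ) A) (z : Fin nr → ℝ) :
    -(nr * (Real.log (2 * Real.pi) / 2)) - ∑ i, (z i ^ 2 + Dbd H A ^ 2)
      ≤ Real.log (fY H μ (H.mulVec x + z)) := by
  rw [Real.le_log_iff_exp_le (fY_pos _ _ _)]
  have := integral_mono_ae
    (integrable_const (Real.exp (-(nr * (Real.log (2 * Real.pi) / 2))
      - ∑ i, (z i ^ 2 + Dbd H A ^ 2)))) (ker_integrable H μ (H.mulVec x + z)) (by
      filter_upwards [hsupp] with x' hx'
      rw [← Real.le_log_iff_exp_le (phn_pos _ _), log_phn]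
      refine sub_le_sub_left (Finset.sum_le_sum fun i _ => ?_) _
      have h := Dbd_bound H hA hx hx' i
      have h2 : (H.mulVec x i - H.mulVec x' i) ^ 2 ≤ Dbd H A ^ 2 := sq_le_sq' (abs_le.1 h).1 (abs_le.1 h).2
      simp only [Pi.sub_apply, Pi.add_apply]
      nlinarith [sq_nonneg (H.mulVec x i - H.mulVec x' i - z i)])
  simpa [fY] using this

lemma info_bounds {nt nr : ℕ} (H : Matrix (Fin nr) (Fin nt) ℝ) (μ : Measure (Fin nt → ℝ))
    [IsProbabilityMeasure μ] {A : ℝ} (hA : 0 < A)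
    (hsupp : ∀ᵐ x ∂μ, ∀ k, x k ∈ Set.Icc (0 : ℝ) A) :
    Integrable (fun p : (Fin nt → ℝ) × (Fin nr → ℝ) =>
      Real.log (fY H μ (H.mulVec p.1 + p.2))) (μ.prod (stdGaussian nr)) ∧
    mutualInfoJoint (jointLaw H μ) ≤ ∑ _i : Fin nr, (1 / 2 + Dbd H A ^ 2) := by
  have hs2 : ∀ᵐ p ∂(μ.prod (stdGaussian nr)), ∀ k, p.1 k ∈ Set.Icc (0 : ℝ) A :=
    Measure.quasiMeasurePreserving_fst.ae hsupp
  have hi : ∀ i, Integrable (fun p : (Fin nt → ℝ) × (Fin nr → ℝ) => p.2 i ^ 2)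
      (μ.prod (stdGaussian nr)) := fun i => (integrable_std_sq nr i).comp_snd μ
  have hlog : Integrable (fun p : (Fin nt → ℝ) × (Fin nr → ℝ) => Real.log (phn nr p.2))
      (μ.prod (stdGaussian nr)) := (integrable_log_phn nr).comp_snd μ
  have hm : Measurable (fun p : (Fin nt → ℝ) × (Fin nr → ℝ) =>
      Real.log (fY H μ (H.mulVec p.1 + p.2))) :=
    Real.measurable_log.comp ((fY_meas H μ).comp
      (((mulVec_cont H).measurable.comp measurable_fst).add measurable_snd))
  have hIntg : Integrable (fun p : (Fin nt → ℝ) × (Fin nr → ℝ) =>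
      Real.log (fY H μ (H.mulVec p.1 + p.2))) (μ.prod (stdGaussian nr)) := by
    refine Integrable.mono' (g := fun p => |(nr * (Real.log (2 * Real.pi) / 2))|
      + ∑ i, (p.2 i ^ 2 + Dbd H A ^ 2)) ?_ hm.aestronglyMeasurable ?_
    · exact (integrable_const _).add
        (integrable_finsetSum _ fun i _ => (hi i).add (integrable_const _))
    · filter_upwards [hs2] with p hp
      have h1 := fY_lower H μ hA hsupp hp p.2
      have h2 : Real.log (fY H μ (H.mulVec p.1 + p.2)) ≤ Real.log (phn nr 0) :=
        Real.log_le_log (fY_pos _ _ _) (fY_le _ _ _)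
      rw [log_phn] at h2
      have h3 : 0 ≤ ∑ i, (p.2 i ^ 2 + Dbd H A ^ 2) := Finset.sum_nonneg fun i _ => by positivity
      have h4 := neg_abs_le (nr * (Real.log (2 * Real.pi) / 2))
      have h5 := le_abs_self (nr * (Real.log (2 * Real.pi) / 2))
      rw [Real.norm_eq_abs, abs_le]
      simp at h2
      constructor <;> linarith
  refine ⟨hIntg, ?_⟩
  rw [info_eq]
  have hle := integral_mono_ae (hlog.sub hIntg)
    (integrable_finsetSum Finset.univ fun i _ =>
      ((hi i).div_const 2).add (integrable_const (Dbd H A ^ 2))) (by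
    filter_upwards [hs2] with p hp
    have h1 := fY_lower H μ hA hsupp hp p.2
    simp only [Pi.sub_apply, Pi.add_apply]
    rw [log_phn]
    rw [Finset.sum_add_distrib] at h1 ⊢
    rw [← Finset.sum_div]
    linarith)
  refine hle.trans (le_of_eq ?_)
  rw [integral_finsetSum _ fun i _ => ((hi i).div_const 2).add (integrable_const (Dbd H A ^ 2))]
  refine Finset.sum_congr rfl fun i _ => ?_
  rw [integral_add' ((hi i).div_const 2) (integrable_const _)]
  rw [integral_div, integral_fun_snd (μ := μ) (ν := stdGaussian nr) (fun z : Fin nr → ℝ => z i ^ 2),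
    integral_std_sq]
  simp

end MimoOptical

namespace MimoOptical

/-! ### Lower bound for a uniformly distributed noiseless output -/

lemma lintegral_fY {nt nr : ℕ} (H : Matrix (Fin nr) (Fin nt) ℝ) (μ : Measure (Fin nt → ℝ))
    [IsProbabilityMeasure μ] : ∫⁻ y, ENNReal.ofReal (fY H μ y) = 1 := by
  have h := congrArg (fun ν : Measure (Fin nr → ℝ) => ν Set.univ) (joint_snd H μ)
  simp only [withDensity_apply _ MeasurableSet.univ, Measure.restrict_univ] at h
  rw [← h, Measure.map_apply measurable_snd MeasurableSet.univ, Set.preimage_univ]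
  unfold jointLaw
  rw [Measure.map_apply (joint_map_meas H) MeasurableSet.univ, Set.preimage_univ]
  exact measure_univ

lemma final_arith (n V : ℝ) (N : ℕ) (hn : n = N) (hV : 0 < V) (I J : ℝ)
    (hI : I = -(n / 2 * Real.log (2 * Real.pi * Real.exp 1)) - V⁻¹ * J)
    (hJ : ∀ a b : ℝ, 0 < a → 0 < b → a ^ 2 + b ^ 2 = 1 → V * Real.log V + J ≤
      V * ((a ^ 2 * Real.log a + b ^ 2 * Real.log b)
        + b ^ 2 * (-(n / 2 * Real.log (2 * Real.pi * Real.exp 1)) + Real.log V))) :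
    1 / 2 * Real.log (1 + V ^ 2 / (2 * Real.pi * Real.exp 1) ^ N) ≤ I := by
  have hE : 0 < 2 * Real.pi * Real.exp 1 := by positivity
  set E := 2 * Real.pi * Real.exp 1
  have hEN : 0 < E ^ N := by positivity
  set T := V ^ 2 / E ^ N with hT
  have hTpos : 0 < T := by positivity
  have hlogT : Real.log T = 2 * Real.log V - n * Real.log E := by
    rw [hT, Real.log_div (by positivity) (by positivity), Real.log_pow, Real.log_pow, hn]
    ring
  clear_value T
  have h1 := hJ (Real.sqrt (T / (1 + T))) (Real.sqrt (1 / (1 + T)))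
    (Real.sqrt_pos.2 (by positivity)) (Real.sqrt_pos.2 (by positivity))
    (by rw [Real.sq_sqrt (by positivity), Real.sq_sqrt (by positivity)]; field_simp; ring)
  rw [Real.sq_sqrt (by positivity), Real.sq_sqrt (by positivity), Real.log_sqrt (by positivity),
    Real.log_sqrt (by positivity), Real.log_div (by positivity) (by positivity),
    Real.log_div (by positivity) (by positivity), Real.log_one] at h1
  have h2 : Real.log V + V⁻¹ * J ≤ (T / (1 + T) * ((Real.log T - Real.log (1 + T)) / 2) +
      1 / (1 + T) * ((0 - Real.log (1 + T)) / 2)) +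
        1 / (1 + T) * (-(n / 2 * Real.log E) + Real.log V) := by
    have := mul_le_mul_of_nonneg_left h1 (inv_pos.2 hV).le
    rw [mul_add, inv_mul_cancel_left₀ hV.ne', inv_mul_cancel_left₀ hV.ne'] at this
    exact this
  have hV' : -(n / 2 * Real.log E) + Real.log V = Real.log T / 2 := by rw [hlogT]; ring
  rw [hV'] at h2
  have h3 : (T / (1 + T) * ((Real.log T - Real.log (1 + T)) / 2) +
      1 / (1 + T) * ((0 - Real.log (1 + T)) / 2)) + 1 / (1 + T) * (Real.log T / 2)
      = Real.log T / 2 - Real.log (1 + T) / 2 := by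
    field_simp; ring
  rw [h3] at h2
  rw [hI]
  linarith

lemma info_lower {nt m : ℕ} (H : Matrix (Fin (m + 1)) (Fin nt) ℝ) (μ : Measure (Fin nt → ℝ))
    [IsProbabilityMeasure μ] {A : ℝ} (hA : 0 < A)
    (hsupp : ∀ᵐ x ∂μ, ∀ k, x k ∈ Set.Icc (0 : ℝ) A)
    {S : Set (Fin (m + 1) → ℝ)} (hS : IsOpen S) (hfin : ∀ r, volume (slice S r) ≠ ∞)
    {V : ℝ} (hV : 0 < V) (hvol : volume S = ENNReal.ofReal V)
    (hmap : μ.map (fun x => H.mulVec x) = (ENNReal.ofReal V)⁻¹ • volume.restrict S) :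
    1 / 2 * Real.log (1 + V ^ 2 / (2 * Real.pi * Real.exp 1) ^ (m + 1))
      ≤ mutualInfoJoint (jointLaw H μ) := by
  have hVne : ENNReal.ofReal V ≠ 0 := by simpa using hV
  have hVinv : (ENNReal.ofReal V)⁻¹ = ENNReal.ofReal V⁻¹ := (ENNReal.ofReal_inv_of_pos hV).symm
  haveI : IsFiniteMeasure (volume.restrict S) :=
    ⟨by rw [Measure.restrict_apply_univ, hvol]; exact ENNReal.ofReal_lt_top⟩
  set γ := stdGaussian (m + 1) with hγ
  set ρ := (volume.restrict S).prod γ with hρ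
  have hiμ := (info_bounds H μ hA hsupp).1
  have hmm := (mulVec_cont H).measurable
  have hmap2 : (μ.prod γ).map (Prod.map (fun x => H.mulVec x) id) = ENNReal.ofReal V⁻¹ • ρ := by
    rw [← Measure.map_prod_map _ _ hmm measurable_id, hmap, Measure.map_id, hVinv,
      Measure.prod_smul_left]
  have hFm : Measurable (fun p : (Fin (m + 1) → ℝ) × (Fin (m + 1) → ℝ) =>
      Real.log (fY H μ (p.1 + p.2))) :=
    Real.measurable_log.comp ((fY_meas H μ).comp (measurable_fst.add measurable_snd))
  have hiρ : Integrable (fun p : (Fin (m + 1) → ℝ) × (Fin (m + 1) → ℝ) =>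
      Real.log (fY H μ (p.1 + p.2))) ρ := by
    have h1 : Integrable (fun p : (Fin (m + 1) → ℝ) × (Fin (m + 1) → ℝ) =>
        Real.log (fY H μ (p.1 + p.2)))
        ((μ.prod γ).map (Prod.map (fun x => H.mulVec x) id)) := by
      rw [integrable_map_measure hFm.aestronglyMeasurable (hmm.prodMap measurable_id).aemeasurable]
      exact hiμ
    rw [hmap2, integrable_smul_measure (by simpa using hV) ENNReal.ofReal_ne_top] at h1
    exact h1
  have hJ : ∫ p, Real.log (fY H μ (H.mulVec p.1 + p.2)) ∂(μ.prod γ)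
      = V⁻¹ * ∫ p, Real.log (fY H μ (p.1 + p.2)) ∂ρ := by
    have h1 := integral_map (μ := μ.prod γ) (φ := Prod.map (fun x => H.mulVec x) id)
      (hmm.prodMap measurable_id).aemeasurable
      (f := fun p : (Fin (m + 1) → ℝ) × (Fin (m + 1) → ℝ) => Real.log (fY H μ (p.1 + p.2)))
      hFm.aestronglyMeasurable
    rw [hmap2, integral_smul_measure, ENNReal.toReal_ofReal (inv_pos.2 hV).le] at h1
    rw [← smul_eq_mul, h1]
    rfl
  refine final_arith ((m + 1 : ℕ) : ℝ) V (m + 1) rfl hV _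
    (∫ p, Real.log (fY H μ (p.1 + p.2)) ∂ρ) ?_ ?_
  · have hlp : Integrable (fun p : (Fin nt → ℝ) × (Fin (m + 1) → ℝ) =>
        Real.log (phn (m + 1) p.2)) (μ.prod γ) := (integrable_log_phn (m + 1)).comp_snd μ
    rw [info_eq, integral_sub hlp hiμ, hJ]
    congr 1
    rw [integral_fun_snd (fun z => Real.log (phn (m + 1) z))]
    simp [hγ, integral_log_phn]
  · intro a b ha hb hab
    have hlog : ∀ y, Real.log (V * fY H μ y) = Real.log V + Real.log (fY H μ y) := fun y =>
      Real.log_mul hV.ne' (fY_pos H μ y).ne'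
    have hIntg : Integrable (fun p : (Fin (m + 1) → ℝ) × (Fin (m + 1) → ℝ) =>
        Real.log (V * fY H μ (p.1 + p.2))) ρ := by
      simp only [hlog]
      exact (integrable_const _).add hiρ
    have h := key_nd hS hfin hV hvol a b ha hb hab (P := fun y => V * fY H μ y)
      ((fY_meas H μ).const_mul V) (fun y => mul_pos hV (fY_pos H μ y)) (by
        simp only [ENNReal.ofReal_mul hV.le]
        rw [lintegral_const_mul _ (fY_meas H μ).ennreal_ofReal, lintegral_fY, mul_one]) hIntg
    refine le_trans (le_of_eq ?_) h
    simp only [hlog]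
    rw [integral_add (integrable_const _) hiρ, integral_const]
    congr 1
    have : ρ.real Set.univ = V := by
      rw [measureReal_def, hρ, ← Set.univ_prod_univ, Measure.prod_prod,
        Measure.restrict_apply_univ, hvol, measure_univ, mul_one, ENNReal.toReal_ofReal hV.le]
    rw [this, smul_eq_mul]

end MimoOptical

namespace MimoOptical

/-! ### Geometry of the cells -/

lemma HU_eq {nt nr : ℕ} (H : Matrix (Fin nr) (Fin nt) ℝ) {U : Finset (Fin nt)}
    (hU : U.card = nr) : HU H U = H.submatrix id (fun i => U.orderEmbOfFin hU i) := by
  simp [HU, hU]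

lemma det_HU_ne {nt nr : ℕ} (H : Matrix (Fin nr) (Fin nt) ℝ) {U : Finset (Fin nt)}
    (hU : U ∈ goodSets H) : (HU H U).det ≠ 0 := by
  obtain ⟨hc, hli⟩ := hU
  have h1 := hli.comp (U.orderIsoOfFin hc) (U.orderIsoOfFin hc).injective
  have h2 : LinearIndependent ℝ (HU H U).col := by
    rw [HU_eq H hc]
    exact h1
  rw [Matrix.linearIndependent_cols_iff_isUnit, Matrix.isUnit_iff_isUnit_det] at h2
  exact h2.ne_zero

lemma goodSets_nonempty {nt nr : ℕ} (H : Matrix (Fin nr) (Fin nt) ℝ) (hrank : H.rank = nr) :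
    (goodSets H).Nonempty := by
  classical
  obtain ⟨κ, a, ha, hsp, hli⟩ := exists_linearIndependent' ℝ H.col
  haveI : Finite κ := Finite.of_injective a ha
  haveI := Fintype.ofFinite κ
  have hcard : Fintype.card κ = nr := by
    rw [← finrank_span_eq_card hli, hsp, ← Matrix.rank_eq_finrank_span_cols, hrank]
  refine ⟨Finset.univ.image a, ?_, ?_⟩
  · rw [Finset.card_image_of_injective _ ha, Finset.card_univ, hcard]
  · have hs : ∀ j : {x // x ∈ Finset.univ.image a}, ∃ k, a k = j.1 := fun j => by
      obtain ⟨k, -, hk⟩ := Finset.mem_image.1 j.2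
      exact ⟨k, hk⟩
    choose s hs using hs
    have hinj : Function.Injective s := fun j j' h => by
      apply Subtype.ext
      rw [← hs j, ← hs j', h]
    have := hli.comp s hinj
    have he : (fun j : {x // x ∈ Finset.univ.image a} => fun i => H i j.1)
        = (H.col ∘ a) ∘ s := by
      funext j i
      simp only [Function.comp, hs]
      rfl
    rw [he]
    exact this

/-- The input vector with free coordinates `t` on `U`. -/
def lft {nt nr : ℕ} (H : Matrix (Fin nr) (Fin nt) ℝ) (A : ℝ) (U : Finset (Fin nt))
    (t : Fin nr → ℝ) : Fin nt → ℝ :=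
  if h : U.card = nr then
    Function.extend (U.orderEmbOfFin h) t (fun j => A * gUj H U j) else 0

lemma lft_emb {nt nr : ℕ} (H : Matrix (Fin nr) (Fin nt) ℝ) (A : ℝ) {U : Finset (Fin nt)}
    (hU : U.card = nr) (t : Fin nr → ℝ) (i : Fin nr) :
    lft H A U t (U.orderEmbOfFin hU i) = t i := by
  simp only [lft, hU, dite_true]
  exact (U.orderEmbOfFin hU).injective.extend_apply _ _ _

lemma lft_not {nt nr : ℕ} (H : Matrix (Fin nr) (Fin nt) ℝ) (A : ℝ) {U : Finset (Fin nt)}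
    (hU : U.card = nr) (t : Fin nr → ℝ) {j : Fin nt} (hj : j ∉ U) :
    lft H A U t j = A * gUj H U j := by
  simp only [lft, hU, dite_true]
  refine Function.extend_apply' _ _ _ ?_
  rintro ⟨i, rfl⟩
  exact hj (U.orderEmbOfFin_mem hU i)

lemma mem_emb {nt nr : ℕ} {U : Finset (Fin nt)} (hU : U.card = nr) {j : Fin nt} (hj : j ∈ U) :
    ∃ i, U.orderEmbOfFin hU i = j := by
  have : j ∈ Set.range (U.orderEmbOfFin hU) := by rw [Finset.range_orderEmbOfFin]; exact hj
  exact this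

lemma sum_split {nt nr : ℕ} {U : Finset (Fin nt)} (hU : U.card = nr) (f : Fin nt → ℝ) :
    ∑ j, f j = ∑ i, f (U.orderEmbOfFin hU i) + ∑ j ∈ Uᶜ, f j := by
  rw [← Finset.sum_add_sum_compl U f]
  congr 1
  conv_lhs => rw [← Finset.map_orderEmbOfFin_univ U hU]
  rw [Finset.sum_map]
  rfl

lemma lft_meas {nt nr : ℕ} (H : Matrix (Fin nr) (Fin nt) ℝ) (A : ℝ) {U : Finset (Fin nt)}
    (hU : U.card = nr) : Measurable (lft H A U) := by
  refine measurable_pi_lambda _ fun j => ?_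
  by_cases hj : j ∈ U
  · obtain ⟨i, rfl⟩ := mem_emb hU hj
    simp only [lft_emb H A hU]
    exact measurable_pi_apply i
  · simp only [lft_not H A hU _ hj]
    exact measurable_const

lemma mulVec_lft {nt nr : ℕ} (H : Matrix (Fin nr) (Fin nt) ℝ) (A : ℝ) {U : Finset (Fin nt)}
    (hU : U.card = nr) (t : Fin nr → ℝ) :
    H.mulVec (lft H A U t) = vU H A U + (HU H U).mulVec t := by
  ext r
  simp only [Matrix.mulVec, dotProduct, Pi.add_apply, vU]
  rw [sum_split hU, add_comm, Finset.mul_sum]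
  congr 1
  · refine Finset.sum_congr rfl fun j hj => ?_
    rw [lft_not H A hU t (Finset.mem_compl.1 hj)]; ring
  · refine Finset.sum_congr rfl fun i _ => ?_
    rw [lft_emb H A hU, HU_eq H hU]; rfl

lemma gUj_mem {nt nr : ℕ} (H : Matrix (Fin nr) (Fin nt) ℝ) (U : Finset (Fin nt)) (j : Fin nt) :
    gUj H U j = 0 ∨ gUj H U j = 1 := by
  unfold gUj; split_ifs <;> simp

lemma lft_mem {nt nr : ℕ} (H : Matrix (Fin nr) (Fin nt) ℝ) {A : ℝ} (hA : 0 < A)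
    {U : Finset (Fin nt)} (hU : U.card = nr) {t : Fin nr → ℝ} (ht : ∀ i, t i ∈ Set.Ioo 0 A)
    (k : Fin nt) : lft H A U t k ∈ Set.Icc 0 A := by
  by_cases hj : k ∈ U
  · obtain ⟨i, rfl⟩ := mem_emb hU hj
    rw [lft_emb H A hU]
    exact Set.Ioo_subset_Icc_self (ht i)
  · rw [lft_not H A hU _ hj]
    rcases gUj_mem H U k with h | h <;> rw [h] <;> simp [hA.le]

/-- A null vector is determined by its coordinates outside `U`. -/
lemma null_sum {nt nr : ℕ} (H : Matrix (Fin nr) (Fin nt) ℝ) {U : Finset (Fin nt)}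
    (hU : U ∈ goodSets H) (d : Fin nt → ℝ) (hd : H.mulVec d = 0) :
    (∑ k, d k = ∑ j ∈ Uᶜ, (1 - aUj H U j) * d j) ∧ ((∀ j ∉ U, d j = 0) → d = 0) := by
  have hc := hU.1
  have hdet : IsUnit (HU H U).det := (det_HU_ne H hU).isUnit
  have key : ∀ i, d (U.orderEmbOfFin hc i)
      = - ∑ j ∈ Uᶜ, d j * ((HU H U)⁻¹).mulVec (fun r => H r j) i := by
    have h1 : (HU H U).mulVec (fun i => d (U.orderEmbOfFin hc i))
        = - ∑ j ∈ Uᶜ, d j • (fun r => H r j) := by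
      ext r
      have h2 := congrFun hd r
      simp only [Matrix.mulVec, dotProduct, Pi.zero_apply] at h2
      rw [sum_split hc] at h2
      simp only [Matrix.mulVec, dotProduct, Pi.neg_apply, Finset.sum_apply, Pi.smul_apply,
        smul_eq_mul]
      rw [HU_eq H hc, eq_neg_iff_add_eq_zero, ← h2]
      congr 1
      exact Finset.sum_congr rfl fun j _ => mul_comm _ _
    have h3 := congrArg ((HU H U)⁻¹).mulVec h1
    rw [Matrix.mulVec_mulVec, Matrix.nonsing_inv_mul _ hdet, Matrix.one_mulVec] at h3
    intro i
    have h4 := congrFun h3 i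
    rw [h4, Matrix.mulVec_neg, Matrix.mulVec_sum]
    simp only [Pi.neg_apply, Finset.sum_apply, Matrix.mulVec_smul, Pi.smul_apply, smul_eq_mul]
  constructor
  · rw [sum_split hc]
    simp only [key]
    rw [Finset.sum_neg_distrib, Finset.sum_comm, ← Finset.sum_neg_distrib,
      ← Finset.sum_add_distrib]
    refine Finset.sum_congr rfl fun j _ => ?_
    rw [← Finset.mul_sum]
    simp only [aUj]
    ring
  · intro h0
    ext k
    by_cases hk : k ∈ U
    · obtain ⟨i, rfl⟩ := mem_emb hc hk
      rw [key, Finset.sum_eq_zero]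
      · simp
      · intro j hj
        rw [h0 j (Finset.mem_compl.1 hj), zero_mul]
    · exact h0 k hk

lemma lft_minimal {nt nr : ℕ} (H : Matrix (Fin nr) (Fin nt) ℝ) {A : ℝ}
    {U : Finset (Fin nt)} (hU : U ∈ goodSets H) (htie : ∀ j ∉ U, aUj H U j ≠ 1)
    (t : Fin nr → ℝ) (x : Fin nt → ℝ) (hx : ∀ k, x k ∈ Set.Icc 0 A)
    (hH : H.mulVec x = H.mulVec (lft H A U t)) :
    ∑ k, lft H A U t k ≤ ∑ k, x k ∧ (∑ k, lft H A U t k = ∑ k, x k → x = lft H A U t) := by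
  have hc := hU.1
  obtain ⟨h1, h2⟩ := null_sum H hU (x - lft H A U t) (by rw [Matrix.mulVec_sub, hH, sub_self])
  simp only [Pi.sub_apply, Finset.sum_sub_distrib] at h1
  have hnn : ∀ j ∈ Uᶜ, 0 ≤ (1 - aUj H U j) * (x j - lft H A U t j) := by
    intro j hj
    rw [lft_not H A hc t (Finset.mem_compl.1 hj)]
    unfold gUj
    have := hx j
    split_ifs with hg
    · exact mul_nonneg_of_nonpos_of_nonpos (by linarith) (by linarith [this.2])
    · exact mul_nonneg (by linarith) (by linarith [this.1])
  refine ⟨by linarith [Finset.sum_nonneg hnn], fun heq => ?_⟩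
  rw [heq, sub_self] at h1
  have h3 := (Finset.sum_eq_zero_iff_of_nonneg hnn).1 h1.symm
  refine sub_eq_zero.1 (h2 fun j hj => ?_)
  rcases mul_eq_zero.1 (h3 j (Finset.mem_compl.2 hj)) with h | h
  · exact absurd (by linarith) (htie j hj)
  · exact h

/-- open cells -/
def ocell {nt nr : ℕ} (H : Matrix (Fin nr) (Fin nt) ℝ) (A : ℝ) (U : Finset (Fin nt)) :
    Set (Fin nr → ℝ) :=
  {y | ((HU H U)⁻¹).mulVec (y - vU H A U) ∈ Set.univ.pi fun _ => Set.Ioo (0 : ℝ) A}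

lemma ocell_open {nt nr : ℕ} (H : Matrix (Fin nr) (Fin nt) ℝ) (A : ℝ) (U : Finset (Fin nt)) :
    IsOpen (ocell H A U) := by
  refine (isOpen_set_pi Set.finite_univ fun _ _ => isOpen_Ioo).preimage ?_
  exact (mulVec_cont _).comp (continuous_id.sub continuous_const)

lemma ocell_preimage {nt nr : ℕ} (H : Matrix (Fin nr) (Fin nt) ℝ) (A : ℝ) {U : Finset (Fin nt)}
    (hU : U ∈ goodSets H) :
    (fun t => vU H A U + (HU H U).mulVec t) ⁻¹' (ocell H A U)
      = Set.univ.pi fun _ => Set.Ioo (0 : ℝ) A := by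
  have hdet : IsUnit (HU H U).det := (det_HU_ne H hU).isUnit
  ext t
  simp only [ocell, Set.mem_preimage, Set.mem_ofPred_eq, add_sub_cancel_left,
    Matrix.mulVec_mulVec, Matrix.nonsing_inv_mul _ hdet, Matrix.one_mulVec]

lemma ocell_exists {nt nr : ℕ} (H : Matrix (Fin nr) (Fin nt) ℝ) (A : ℝ) {U : Finset (Fin nt)}
    (hU : U ∈ goodSets H) {y : Fin nr → ℝ} (hy : y ∈ ocell H A U) :
    ∃ t : Fin nr → ℝ, (∀ i, t i ∈ Set.Ioo 0 A) ∧ y = H.mulVec (lft H A U t) := by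
  have hdet : IsUnit (HU H U).det := (det_HU_ne H hU).isUnit
  refine ⟨((HU H U)⁻¹).mulVec (y - vU H A U), fun i => hy i (Set.mem_univ _), ?_⟩
  rw [mulVec_lft H A hU.1, Matrix.mulVec_mulVec, Matrix.mul_nonsing_inv _ hdet,
    Matrix.one_mulVec, add_sub_cancel]

lemma ocell_disjoint {nt nr : ℕ} (H : Matrix (Fin nr) (Fin nt) ℝ) {A : ℝ} (hA : 0 < A)
    (htie : ∀ U ∈ goodSets H, ∀ j ∉ U, aUj H U j ≠ 1) {U U' : Finset (Fin nt)}
    (hU : U ∈ goodSets H) (hU' : U' ∈ goodSets H) (hne : U ≠ U') :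
    Disjoint (ocell H A U) (ocell H A U') := by
  rw [Set.disjoint_left]
  intro y hy hy'
  obtain ⟨t, ht, h1⟩ := ocell_exists H A hU hy
  obtain ⟨t', ht', h2⟩ := ocell_exists H A hU' hy'
  obtain ⟨a1, b1⟩ := lft_minimal H hU (htie U hU) t (lft H A U' t') (lft_mem H hA hU'.1 ht')
    (by rw [← h1, ← h2])
  obtain ⟨a2, b2⟩ := lft_minimal H hU' (htie U' hU') t' (lft H A U t) (lft_mem H hA hU.1 ht)
    (by rw [← h1, ← h2])
  have heq := b1 (le_antisymm a1 a2)
  have hns : ¬ U ⊆ U' := fun hs => hne (Finset.eq_of_subset_of_card_le hs (by rw [hU.1, hU'.1]))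
  obtain ⟨j, hj, hj'⟩ := Finset.not_subset.1 hns
  obtain ⟨i, hi⟩ := mem_emb hU.1 hj
  have h3 := congrFun heq j
  rw [lft_not H A hU'.1 t' hj', ← hi, lft_emb H A hU.1] at h3
  have h4 := ht i
  rcases gUj_mem H U' (U.orderEmbOfFin hU.1 i) with h | h <;> rw [h] at h3
  · linarith [h4.1]
  · linarith [h4.2]

end MimoOptical

namespace MimoOptical

/-! ### The input distribution -/

/-- the open cube -/
def cube (n : ℕ) (A : ℝ) : Set (Fin n → ℝ) := Set.univ.pi fun _ => Set.Ioo (0 : ℝ) A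

lemma cube_meas (n : ℕ) (A : ℝ) : MeasurableSet (cube n A) :=
  (isOpen_set_pi Set.finite_univ fun _ _ => isOpen_Ioo).measurableSet

lemma cube_vol (n : ℕ) {A : ℝ} (hA : 0 < A) : volume (cube n A) = ENNReal.ofReal (A ^ n) := by
  rw [cube, volume_pi_pi]
  simp [ENNReal.ofReal_pow hA.le]

lemma cube_integral {n : ℕ} {A : ℝ} (hA : 0 < A) (i : Fin n) :
    ∫ t in cube n A, t i = A ^ n * (A / 2) := by
  have h1 : (volume : Measure (Fin n → ℝ)).restrict (cube n A)
      = Measure.pi fun _ : Fin n => (volume : Measure ℝ).restrict (Set.Ioo 0 A) := by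
    rw [cube, volume_pi, Measure.restrict_pi_pi]
  have h2 := integral_map (μ := Measure.pi fun _ : Fin n => (volume : Measure ℝ).restrict
    (Set.Ioo 0 A)) (φ := Function.eval i) (measurable_pi_apply i).aemeasurable (f := fun x : ℝ => x)
    measurable_id.aestronglyMeasurable
  rw [h1]
  refine h2.symm.trans ?_
  rw [Measure.pi_map_eval, integral_smul_measure]
  have h3 : ∫ x in Set.Ioo 0 A, x = A ^ 2 / 2 := by
    rw [← integral_Ioc_eq_integral_Ioo, ← intervalIntegral.integral_of_le hA.le, integral_id]
    ring
  rw [h3]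
  have hn : n ≠ 0 := fun h => by subst h; exact i.elim0
  simp [hA.le, ENNReal.toReal_prod]
  rw [← pow_sub_one_mul hn A]
  ring

/-- good sets as a finset -/
def gS {nt nr : ℕ} (H : Matrix (Fin nr) (Fin nt) ℝ) : Finset (Finset (Fin nt)) :=
  (Set.toFinite (goodSets H)).toFinset

lemma mem_gS {nt nr : ℕ} (H : Matrix (Fin nr) (Fin nt) ℝ) (U : Finset (Fin nt)) :
    U ∈ gS H ↔ U ∈ goodSets H := by simp [gS]

lemma VH_eq {nt nr : ℕ} (H : Matrix (Fin nr) (Fin nt) ℝ) :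
    VH H = ∑ U ∈ gS H, |(HU H U).det| :=
  finsum_mem_eq_finite_toFinset_sum _ _

lemma alphaTh_eq {nt nr : ℕ} (H : Matrix (Fin nr) (Fin nt) ℝ) :
    alphaTh H = (nr : ℝ) / 2 + ∑ U ∈ gS H, sU H U * qU H U := by
  rw [alphaTh, gS, finsum_mem_eq_finite_toFinset_sum]

lemma VH_pos {nt nr : ℕ} (H : Matrix (Fin nr) (Fin nt) ℝ) (hrank : H.rank = nr) : 0 < VH H := by
  rw [VH_eq]
  obtain ⟨U, hU⟩ := goodSets_nonempty H hrank
  exact Finset.sum_pos (fun U hU => abs_pos.2 (det_HU_ne H ((mem_gS H U).1 hU)))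
    ⟨U, (mem_gS H U).2 hU⟩

/-- the part of the input law sitting over `U` -/
def muU {nt nr : ℕ} (H : Matrix (Fin nr) (Fin nt) ℝ) (A : ℝ) (U : Finset (Fin nt)) :
    Measure (Fin nt → ℝ) :=
  ENNReal.ofReal (|(HU H U).det| / (A ^ nr * VH H)) •
    ((volume.restrict (cube nr A)).map (lft H A U))

/-- the input law -/
def muIn {nt nr : ℕ} (H : Matrix (Fin nr) (Fin nt) ℝ) (A : ℝ) : Measure (Fin nt → ℝ) :=
  ∑ U ∈ gS H, muU H A U

lemma muU_univ {nt nr : ℕ} (H : Matrix (Fin nr) (Fin nt) ℝ) {A : ℝ} (hA : 0 < A)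
    {U : Finset (Fin nt)} (hU : U ∈ goodSets H) :
    muU H A U Set.univ = ENNReal.ofReal (|(HU H U).det| / VH H) := by
  rw [muU, Measure.smul_apply, Measure.map_apply (lft_meas H A hU.1) MeasurableSet.univ,
    Set.preimage_univ, Measure.restrict_apply_univ, cube_vol _ hA, smul_eq_mul,
    ← ENNReal.ofReal_mul' (by positivity)]
  congr 1
  field_simp

lemma muIn_prob {nt nr : ℕ} (H : Matrix (Fin nr) (Fin nt) ℝ) (hrank : H.rank = nr) {A : ℝ}
    (hA : 0 < A) : IsProbabilityMeasure (muIn H A) := by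
  have hV := VH_pos H hrank
  constructor
  rw [muIn, Measure.finsetSum_apply, Finset.sum_congr rfl fun U hU =>
    muU_univ H hA ((mem_gS H U).1 hU), ← ENNReal.ofReal_sum_of_nonneg fun U _ => by positivity,
    ← Finset.sum_div, ← VH_eq, div_self hV.ne', ENNReal.ofReal_one]

lemma muU_supp {nt nr : ℕ} (H : Matrix (Fin nr) (Fin nt) ℝ) {A : ℝ}
    (hA : 0 < A) {U : Finset (Fin nt)} (hU : U ∈ goodSets H) :
    ∀ᵐ x ∂(muU H A U), ∀ k, x k ∈ Set.Icc (0 : ℝ) A := by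
  refine Measure.ae_smul_measure ?_ _
  have hm : MeasurableSet {x : Fin nt → ℝ | ∀ k, x k ∈ Set.Icc (0 : ℝ) A} := by
    have : {x : Fin nt → ℝ | ∀ k, x k ∈ Set.Icc (0 : ℝ) A}
        = ⋂ k, (fun x : Fin nt → ℝ => x k) ⁻¹' Set.Icc (0 : ℝ) A := by ext x; simp
    rw [this]
    exact MeasurableSet.iInter fun k => measurable_pi_apply k measurableSet_Icc
  rw [ae_map_iff (lft_meas H A hU.1).aemeasurable hm]
  refine (ae_restrict_mem (cube_meas nr A)).mono fun t ht => ?_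
  exact lft_mem H hA hU.1 fun i => ht i (Set.mem_univ _)

lemma ae_muIn {nt nr : ℕ} (H : Matrix (Fin nr) (Fin nt) ℝ) {A : ℝ} {p : (Fin nt → ℝ) → Prop}
    (h : ∀ U ∈ gS H, ∀ᵐ x ∂(muU H A U), p x) : ∀ᵐ x ∂(muIn H A), p x := by
  rw [ae_iff, muIn, Measure.finsetSum_apply]
  exact Finset.sum_eq_zero fun U hU => ae_iff.1 (h U hU)

lemma muIn_supp {nt nr : ℕ} (H : Matrix (Fin nr) (Fin nt) ℝ) {A : ℝ}
    (hA : 0 < A) : ∀ᵐ x ∂(muIn H A), ∀ k, x k ∈ Set.Icc (0 : ℝ) A :=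
  ae_muIn H fun U hU => muU_supp H hA ((mem_gS H U).1 hU)

lemma muU_fin {nt nr : ℕ} (H : Matrix (Fin nr) (Fin nt) ℝ) {A : ℝ} (hA : 0 < A)
    {U : Finset (Fin nt)} (hU : U ∈ goodSets H) : IsFiniteMeasure (muU H A U) :=
  ⟨by rw [muU_univ H hA hU]; exact ENNReal.ofReal_lt_top⟩

lemma cube_integrable {n : ℕ} {A : ℝ} (hA : 0 < A) (i : Fin n) :
    Integrable (fun t : Fin n → ℝ => t i) (volume.restrict (cube n A)) := by
  have : IsFiniteMeasure ((volume : Measure (Fin n → ℝ)).restrict (cube n A)) :=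
    ⟨by rw [Measure.restrict_apply_univ, cube_vol _ hA]; exact ENNReal.ofReal_lt_top⟩
  refine Integrable.of_bound (C := A) (measurable_pi_apply i).aestronglyMeasurable ?_
  refine (ae_restrict_mem (cube_meas n A)).mono fun t ht => ?_
  have := ht i (Set.mem_univ _)
  rw [Real.norm_eq_abs, abs_of_pos this.1]
  exact this.2.le

lemma muU_energy {nt nr : ℕ} (H : Matrix (Fin nr) (Fin nt) ℝ) {A : ℝ} (hA : 0 < A)
    {U : Finset (Fin nt)} (hU : U ∈ goodSets H) :
    ∫ x, ∑ k, |x k| ∂(muU H A U) = A * (qU H U * (nr / 2) + sU H U * qU H U) := by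
  have hc := hU.1
  have hfin : IsFiniteMeasure ((volume : Measure (Fin nr → ℝ)).restrict (cube nr A)) :=
    ⟨by rw [Measure.restrict_apply_univ, cube_vol _ hA]; exact ENNReal.ofReal_lt_top⟩
  have hm : Measurable (fun x : Fin nt → ℝ => ∑ k, |x k|) :=
    Finset.measurable_sum _ fun k _ => (measurable_pi_apply k).abs
  have h1 : ∫ t in cube nr A, ∑ k, |lft H A U t k|
      = A ^ nr * (A * (nr / 2 + sU H U)) := by
    have h2 : ∫ t in cube nr A, ∑ k, |lft H A U t k|
        = ∫ t in cube nr A, (∑ i, t i + A * sU H U) := by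
      refine setIntegral_congr_fun (cube_meas nr A) fun t ht => ?_
      have hh : ∀ k, |lft H A U t k| = lft H A U t k := fun k =>
        abs_of_nonneg (lft_mem H hA hc (fun i => ht i (Set.mem_univ _)) k).1
      simp only [hh]
      rw [sum_split hc, sU, Finset.mul_sum]
      congr 1
      · exact Finset.sum_congr rfl fun i _ => lft_emb H A hc t i
      · exact Finset.sum_congr rfl fun j hj => lft_not H A hc t (Finset.mem_compl.1 hj)
    rw [h2, integral_add (integrable_finsetSum _ fun i _ => cube_integrable hA i)
      (integrable_const _), integral_finsetSum _ fun i _ => cube_integrable hA i,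
      integral_const]
    simp only [cube_integral hA, measureReal_def, Measure.restrict_apply_univ, cube_vol nr hA]
    rw [ENNReal.toReal_ofReal (by positivity)]
    simp
    ring
  have hV : 0 ≤ VH H := by rw [VH_eq]; positivity
  rw [muU, integral_smul_measure, integral_map (lft_meas H A hc).aemeasurable
    hm.aestronglyMeasurable, h1, ENNReal.toReal_ofReal (by positivity), qU, smul_eq_mul]
  field_simp

lemma muIn_energy {nt nr : ℕ} (H : Matrix (Fin nr) (Fin nt) ℝ) (hrank : H.rank = nr) {A : ℝ}
    (hA : 0 < A) : ∫ x, ∑ k, |x k| ∂(muIn H A) = alphaTh H * A := by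
  have hV := VH_pos H hrank
  have hm : Measurable (fun x : Fin nt → ℝ => ∑ k, |x k|) :=
    Finset.measurable_sum _ fun k _ => (measurable_pi_apply k).abs
  rw [muIn, integral_finsetSum_measure]
  · rw [Finset.sum_congr rfl fun U hU => muU_energy H hA ((mem_gS H U).1 hU), ← Finset.mul_sum,
      Finset.sum_add_distrib, ← Finset.sum_mul, alphaTh_eq]
    have : ∑ U ∈ gS H, qU H U = 1 := by
      simp only [qU]
      rw [← Finset.sum_div, ← VH_eq, div_self hV.ne']
    rw [this]
    ring
  · intro U hU
    have hU := (mem_gS H U).1 hU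
    have := muU_fin H hA hU
    refine Integrable.of_bound (C := ∑ _k : Fin nt, A) hm.aestronglyMeasurable ?_
    refine (muU_supp H hA hU).mono fun x hx => ?_
    rw [Real.norm_eq_abs, abs_of_nonneg (Finset.sum_nonneg fun k _ => abs_nonneg _)]
    refine Finset.sum_le_sum fun k _ => ?_
    rw [abs_of_nonneg (hx k).1]
    exact (hx k).2

/-- the support of the noiseless output -/
def outS {nt nr : ℕ} (H : Matrix (Fin nr) (Fin nt) ℝ) (A : ℝ) : Set (Fin nr → ℝ) :=
  ⋃ U ∈ gS H, ocell H A U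

lemma outS_open {nt nr : ℕ} (H : Matrix (Fin nr) (Fin nt) ℝ) (A : ℝ) : IsOpen (outS H A) :=
  isOpen_biUnion fun U _ => ocell_open H A U

lemma muU_map {nt nr : ℕ} (H : Matrix (Fin nr) (Fin nt) ℝ) {A : ℝ} (hA : 0 < A)
    {U : Finset (Fin nt)} (hU : U ∈ goodSets H) :
    (muU H A U).map (fun x => H.mulVec x)
      = (ENNReal.ofReal (A ^ nr * VH H))⁻¹ • volume.restrict (ocell H A U) := by
  have hdet := det_HU_ne H hU
  have hV : 0 < VH H := by
    rw [VH_eq]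
    exact Finset.sum_pos (fun U hU => abs_pos.2 (det_HU_ne H ((mem_gS H U).1 hU)))
      ⟨U, (mem_gS H U).2 hU⟩
  have hmm := (mulVec_cont H).measurable
  have hphi : Measurable (fun t => vU H A U + (HU H U).mulVec t) :=
    measurable_const.add (mulVec_cont _).measurable
  have hvol : (volume : Measure (Fin nr → ℝ)).map (fun t => vU H A U + (HU H U).mulVec t)
      = ENNReal.ofReal |(HU H U).det⁻¹| • volume := by
    have h1 := Real.map_matrix_volume_pi_eq_smul_volume_pi hdet
    have h2 : (fun t => vU H A U + (HU H U).mulVec t)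
        = (fun y => vU H A U + y) ∘ (Matrix.toLin' (HU H U)) := by
      funext t; simp
    rw [h2, ← Measure.map_map (measurable_const_add _)
      (by exact (Matrix.toLin' (HU H U)).continuous_of_finiteDimensional.measurable), h1,
      Measure.map_smul, map_add_left_eq_self]
  rw [muU, Measure.map_smul, Measure.map_map hmm (lft_meas H A hU.1)]
  have hcomp : ((fun x => H.mulVec x) ∘ lft H A U)
      = (fun t => vU H A U + (HU H U).mulVec t) := by
    funext t; exact mulVec_lft H A hU.1 t
  have h3 := Measure.restrict_map (μ := volume) hphi (ocell_open H A U).measurableSet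
  rw [ocell_preimage H A hU, hvol, Measure.restrict_smul] at h3
  rw [hcomp, cube, ← h3, smul_smul, ← ENNReal.ofReal_mul (by positivity),
    ← ENNReal.ofReal_inv_of_pos (by positivity)]
  congr 2
  rw [abs_inv]
  have := abs_pos.2 hdet
  field_simp

lemma muIn_map {nt nr : ℕ} (H : Matrix (Fin nr) (Fin nt) ℝ) {A : ℝ} (hA : 0 < A)
    (htie : ∀ U ∈ goodSets H, ∀ j ∉ U, aUj H U j ≠ 1) :
    (muIn H A).map (fun x => H.mulVec x)
      = (ENNReal.ofReal (A ^ nr * VH H))⁻¹ • volume.restrict (outS H A) := by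
  rw [muIn, Measure.map_finset_sum (mulVec_cont H).measurable.aemeasurable,
    Finset.sum_congr rfl fun U hU => muU_map H hA ((mem_gS H U).1 hU), ← Finset.smul_sum,
    outS, Measure.restrict_biUnion_finset, Measure.sum_coe_finset (gS H)
      (fun U => volume.restrict (ocell H A U))]
  · intro U hU U' hU' hne
    exact ocell_disjoint H hA htie ((mem_gS H U).1 hU) ((mem_gS H U').1 hU') hne
  · exact fun U => (ocell_open H A U).measurableSet

lemma outS_vol {nt nr : ℕ} (H : Matrix (Fin nr) (Fin nt) ℝ) (hrank : H.rank = nr)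
    {A : ℝ} (hA : 0 < A) (htie : ∀ U ∈ goodSets H, ∀ j ∉ U, aUj H U j ≠ 1) :
    volume (outS H A) = ENNReal.ofReal (A ^ nr * VH H) := by
  have hV := VH_pos H hrank
  have := muIn_prob H hrank hA
  have h := congrArg (fun ν : Measure (Fin nr → ℝ) => ν Set.univ) (muIn_map H hA htie)
  simp only [Measure.map_apply (mulVec_cont H).measurable MeasurableSet.univ, Set.preimage_univ,
    measure_univ, Measure.smul_apply, Measure.restrict_apply_univ, smul_eq_mul] at h
  have h0 : ENNReal.ofReal (A ^ nr * VH H) ≠ 0 := by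
    simp only [ne_eq, ENNReal.ofReal_eq_zero, not_le]; positivity
  rw [← one_mul (ENNReal.ofReal (A ^ nr * VH H)), h, mul_comm, ← mul_assoc,
    ENNReal.mul_inv_cancel h0 ENNReal.ofReal_ne_top, one_mul]

lemma outS_slice {nt m : ℕ} (H : Matrix (Fin (m + 1)) (Fin nt) ℝ) {A : ℝ} (hA : 0 < A)
    (r : Fin m → ℝ) : volume (slice (outS H A) r) ≠ ∞ := by
  have hK : IsCompact ((fun x : Fin nt → ℝ => H.mulVec x 0) ''
      (Set.univ.pi fun _ => Set.Icc (0 : ℝ) A)) :=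
    (isCompact_univ_pi fun _ => isCompact_Icc).image ((continuous_apply 0).comp (mulVec_cont H))
  refine ne_top_of_le_ne_top hK.measure_lt_top.ne (measure_mono ?_)
  intro s hs
  have hs' : (Fin.cons s r : Fin (m + 1) → ℝ) ∈ outS H A := hs
  simp only [outS, Set.mem_iUnion] at hs'
  obtain ⟨U, hU, hy⟩ := hs'
  have hU := (mem_gS H U).1 hU
  obtain ⟨t, ht, h1⟩ := ocell_exists H A hU hy
  refine ⟨lft H A U t, fun k _ => lft_mem H hA hU.1 ht k, ?_⟩
  have := congrFun h1 0
  rw [Fin.cons_zero] at this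
  exact this.symm

end MimoOptical

/-- If `α ≥ α_th`, then
`C_H(A, αA) ≥ (1/2) log(1 + A^{2nr} V_H² / (2πe)^{nr})`. -/
theorem MimoOptical.capacity_lower_bound_of_alphaTh_le
    (nt nr : ℕ) (hnr : 1 ≤ nr) (hntnr : nr < nt)
    (H : Matrix (Fin nr) (Fin nt) ℝ) (hrank : H.rank = nr)
    (A α : ℝ) (hA : 0 < A) (hα : 0 < α)
    (htie : ∀ U ∈ MimoOptical.goodSets H, ∀ j ∉ U, MimoOptical.aUj H U j ≠ 1)
    (h : MimoOptical.alphaTh H ≤ α) :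
    (1 / 2) * Real.log (1 + A ^ (2 * nr) * (MimoOptical.VH H) ^ 2
        / (2 * Real.pi * Real.exp 1) ^ nr)
      ≤ MimoOptical.capacity H A (α * A) := by
  obtain ⟨m, rfl⟩ : ∃ m, nr = m + 1 := ⟨nr - 1, by omega⟩
  have hV := VH_pos H hrank
  have hp := muIn_prob H hrank hA
  have hI := info_lower H (muIn H A) hA (muIn_supp H hA) (outS_open H A) (outS_slice H hA)
    (V := A ^ (m + 1) * VH H) (by positivity) (outS_vol H hrank hA htie) (muIn_map H hA htie)
  have he : (A ^ (m + 1) * VH H) ^ 2 = A ^ (2 * (m + 1)) * VH H ^ 2 := by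
    rw [mul_pow, ← pow_mul, mul_comm (m + 1) 2]
  rw [he] at hI
  refine hI.trans (le_csSup ?_ ⟨muIn H A, ⟨hp, muIn_supp H hA, ?_⟩, rfl⟩)
  · refine ⟨∑ _i : Fin (m + 1), (1 / 2 + Dbd H A ^ 2), ?_⟩
    rintro c ⟨μ, ⟨hμ, hs, -⟩, rfl⟩
    exact (info_bounds H μ hA hs).2
  · rw [muIn_energy H hrank hA]
    exact mul_le_mul_of_nonneg_right h hA.le
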